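/- arXiv:2009.12884 — 3 statements merged into one kernel-verified Lean document; each statement's English description precedes it below -/
import Mathlib

section
/- Conditional comparison principle via averaged translations: Let α, β ∈ (0,1) with α(1+β) > 1 and A¹, A² ∈ C^α_t C^β_V, and let x¹, x² ∈ C^α([0,T];V) be solutions of the YDEs x^i_t = x^i_0 + ∫_0^t A^i(ds, x^i_s) (i.e. ‖x^i_t − x^i_s − A^i_{s,t}(x^i_s)‖_V ≤ K_i (t−s)^{α(1+β)} for some K_i and all s ≤ t). Suppose there exists B : [0,T] × V → V with B(0,·) = 0 and ‖B‖_{α,1} := sup_{s<t} [sup_z ‖B_{s,t}(z)‖_V + sup_{x≠y} ‖B_{s,t}(x) − B_{s,t}(y)‖_V/‖x−y‖_V]/(t−s)^α < ∞, and a constant κ₀ such that ‖B_{s,t}(z) − A¹_{s,t}(z + x¹_s)‖_V ≤ κ₀ (t−s)^{α(1+β)} for all z ∈ V and 0 ≤ s ≤ t ≤ T (i.e. B is the averaged translation τ_{x¹}A¹ and lies in C^α_t Lip_V). Then there exists C = C(α,β,T) such that ‖x¹ − x²‖_α ≤ C exp(C ‖B‖_{α,1}^{1/α}) (1 + ‖A²‖_{α,β}²)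 (‖x¹_0 − x²_0‖_V + ‖A¹ − A²‖_{α,β}). In particular, x¹ is the unique solution in C^α([0,T];V) of the YDE associated to (x¹_0, A¹). -/
open Filter Topology

/-- A-priori sewing estimate: a path that is close to a germ up to *some* constant of order
`θ > 1` is close to it with a constant controlled by the coboundary of the germ. -/
lemma sewing_estimate {V : Type*} [NormedAddCommGroup V] (f : ℝ → V) (G : ℝ → ℝ → V)
    (φ : ℝ → ℝ) (a b θ K : ℝ) (hθ : 1 < θ)
    (hR : ∀ s t, a ≤ s → s ≤ t → t ≤ b → ‖f t - f s - G s t‖ ≤ K * (t - s) ^ θ)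
    (hδ : ∀ s u t, a ≤ s → s ≤ u → u ≤ t → t ≤ b → ‖G s t - G s u - G u t‖ ≤ φ (t - s))
    (hφ : ∀ h, 0 ≤ h → 2 * φ (h / 2) ≤ (2 : ℝ) ^ (1 - θ) * φ h)
    (s t : ℝ) (has : a ≤ s) (hst : s ≤ t) (htb : t ≤ b) :
    ‖f t - f s - G s t‖ ≤ (1 - (2 : ℝ) ^ (1 - θ))⁻¹ * φ (t - s) := by
  set l : ℝ := (2 : ℝ) ^ (1 - θ) with hl
  have hl0 : 0 < l := by positivity
  have hl1 : l < 1 := Real.rpow_lt_one_of_one_lt_of_neg (by norm_num) (by linarith)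
  have hc : (1 - l)⁻¹ = (1 - l)⁻¹ * l + 1 := by
    have : 1 - l ≠ 0 := by linarith
    field_simp
    ring
  have hc0 : 0 < (1 - l)⁻¹ := inv_pos.2 (by linarith)
  set c := (1 - l)⁻¹
  have key : ∀ n : ℕ, ∀ s t, a ≤ s → s ≤ t → t ≤ b →
      ‖f t - f s - G s t‖ ≤ c * φ (t - s) + l ^ n * (K * (t - s) ^ θ) := by
    intro n
    induction n with
    | zero =>
      intro s t has hst htb
      have hφ0 : 0 ≤ φ (t - s) := (norm_nonneg _).trans (hδ s s t has le_rfl hst htb)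
      have := hR s t has hst htb
      have := mul_nonneg hc0.le hφ0
      simp only [pow_zero, one_mul]
      linarith
    | succ n ih =>
      intro s t has hst htb
      have h1 := ih s ((s + t) / 2) has (by linarith) (by linarith)
      have h2 := ih ((s + t) / 2) t (by linarith) (by linarith) htb
      have h3 := hδ s ((s + t) / 2) t has (by linarith) (by linarith) htb
      have e1 : (s + t) / 2 - s = (t - s) / 2 := by ring
      have e2 : t - (s + t) / 2 = (t - s) / 2 := by ring
      rw [e1] at h1
      rw [e2] at h2
      have h4 := hφ (t - s) (by linarith)
      have hpow : 2 * ((t - s) / 2) ^ θ = l * (t - s) ^ θ := by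
        rw [Real.div_rpow (by linarith) (by norm_num), hl, Real.rpow_sub (by norm_num),
          Real.rpow_one]
        ring
      have e : f t - f s - G s t = (f ((s + t) / 2) - f s - G s ((s + t) / 2))
          + (f t - f ((s + t) / 2) - G ((s + t) / 2) t)
          - (G s t - G s ((s + t) / 2) - G ((s + t) / 2) t) := by abel
      rw [e]
      refine (norm_sub_le _ _).trans ((add_le_add (norm_add_le _ _) le_rfl).trans ?_)
      have h5 := mul_le_mul_of_nonneg_left h4 hc0.le
      have h6 : l ^ (n + 1) * (K * (t - s) ^ θ) = 2 * (l ^ n * (K * ((t - s) / 2) ^ θ)) := by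
        rw [pow_succ]
        linear_combination (-(l ^ n * K)) * hpow
      have h7 : c * φ (t - s) = c * (l * φ (t - s)) + φ (t - s) := by
        linear_combination (φ (t - s)) * hc
      linarith
  have lim : Tendsto (fun n : ℕ => c * φ (t - s) + l ^ n * (K * (t - s) ^ θ)) atTop
      (𝓝 (c * φ (t - s) + 0 * (K * (t - s) ^ θ))) :=
    ((tendsto_pow_atTop_nhds_zero_of_lt_one hl0.le hl1).mul_const _).const_add _
  rw [zero_mul, add_zero] at lim
  exact ge_of_tendsto' lim fun n => key n s t has hst htb

/-- Absorption of half of a finite Hölder seminorm. -/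
lemma holder_absorb {V : Type*} [NormedAddCommGroup V] (Q : ℝ → ℝ → Prop) (f : ℝ → V)
    (α K P : ℝ) (hP : 0 ≤ P)
    (hQ : ∀ s t, Q s t → s ≤ t)
    (hK : ∀ s t, Q s t → ‖f t - f s‖ ≤ K * (t - s) ^ α)
    (step : ∀ Y, 0 ≤ Y → (∀ s t, Q s t → ‖f t - f s‖ ≤ Y * (t - s) ^ α) →
      ∀ s t, Q s t → ‖f t - f s‖ ≤ (P + Y / 2) * (t - s) ^ α)
    (s t : ℝ) (hst : Q s t) : ‖f t - f s‖ ≤ 2 * P * (t - s) ^ α := by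
  have key : ∀ n : ℕ, ∀ s t, Q s t →
      ‖f t - f s‖ ≤ (2 * P + (1 / 2 : ℝ) ^ n * |K|) * (t - s) ^ α := by
    intro n
    induction n with
    | zero =>
      intro s t h
      refine (hK s t h).trans ?_
      have := Real.rpow_nonneg (sub_nonneg.2 (hQ s t h)) α
      gcongr
      have := le_abs_self K
      simp only [pow_zero, one_mul]
      linarith
    | succ n ih =>
      intro s t h
      have := step _ (by positivity) ih s t h
      convert this using 2
      ring
  have lim : Tendsto (fun n : ℕ => (2 * P + (1 / 2 : ℝ) ^ n * |K|) * (t - s) ^ α) atTop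
      (𝓝 ((2 * P + 0 * |K|) * (t - s) ^ α)) :=
    (((tendsto_pow_atTop_nhds_zero_of_lt_one (by norm_num) (by norm_num)).mul_const _).const_add
      _).mul_const _
  rw [zero_mul, add_zero] at lim
  exact ge_of_tendsto' lim fun n => key n s t hst

/-- Passing from a Hölder bound on intervals of length at most `T / N` to one on `[0, T]`. -/
lemma holder_of_local {V : Type*} [NormedAddCommGroup V] (f : ℝ → V) (α T Y : ℝ) (N : ℕ)
    (hN : 0 < N)
    (hloc : ∀ s t, 0 ≤ s → s ≤ t → t ≤ T → t - s ≤ T / N → ‖f t - f s‖ ≤ Y * (t - s) ^ α)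
    (s t : ℝ) (hs : 0 ≤ s) (hst : s ≤ t) (htT : t ≤ T) :
    ‖f t - f s‖ ≤ (N : ℝ) ^ (1 - α) * Y * (t - s) ^ α := by
  have hN' : (0 : ℝ) < N := by exact_mod_cast hN
  set d : ℝ := (t - s) / N with hd
  have hd0 : 0 ≤ d := div_nonneg (by linarith) hN'.le
  have hNd : N * d = t - s := by rw [hd]; field_simp
  have key : ∀ k : ℕ, k ≤ N → ‖f (s + k * d) - f s‖ ≤ k * (Y * d ^ α) := by
    intro k
    induction k with
    | zero => intro _; simp
    | succ k ih =>
      intro hk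
      have h1 := ih (by omega)
      have hk' : ((k + 1 : ℕ) : ℝ) ≤ N := by exact_mod_cast hk
      have hkd : ((k + 1 : ℕ) : ℝ) * d ≤ N * d := by gcongr
      have e : s + ((k + 1 : ℕ) : ℝ) * d - (s + k * d) = d := by push_cast; ring
      have h2 := hloc (s + k * d) (s + ((k + 1 : ℕ) : ℝ) * d) (by positivity) (by linarith)
        (by linarith) (by rw [e, hd]; gcongr; linarith)
      rw [e] at h2
      have := norm_sub_le_norm_sub_add_norm_sub (f (s + ((k + 1 : ℕ) : ℝ) * d)) (f (s + k * d))
        (f s)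
      calc _ ≤ _ := this
        _ ≤ Y * d ^ α + k * (Y * d ^ α) := add_le_add h2 h1
        _ = _ := by push_cast; ring
  have h := key N le_rfl
  rw [hNd, add_sub_cancel] at h
  refine h.trans (le_of_eq ?_)
  rw [hd, Real.div_rpow (by linarith) hN'.le, Real.rpow_sub hN', Real.rpow_one]
  ring

lemma rpow_le_one_add {x p : ℝ} (hx : 0 ≤ x) (hp0 : 0 ≤ p) (hp1 : p ≤ 1) : x ^ p ≤ 1 + x := by
  calc x ^ p ≤ (1 + x) ^ p := Real.rpow_le_rpow hx (by linarith) hp0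
    _ ≤ (1 + x) ^ (1 : ℝ) := Real.rpow_le_rpow_of_exponent_le (by linarith) hp1
    _ = 1 + x := Real.rpow_one _

/-- A number of subdivisions making `L * (T / N) ^ p` small. -/
lemma exists_subdivision (T L p : ℝ) (hT : 0 < T) (hL : 0 ≤ L) (hp : 0 < p) :
    ∃ N : ℕ, 0 < N ∧ (N : ℝ) ≤ T * L ^ (1 / p) + 2 ∧ L * (T / N) ^ p ≤ 1 := by
  have h0 : 0 ≤ T * L ^ (1 / p) := by positivity
  refine ⟨⌈T * L ^ (1 / p)⌉₊ + 1, by omega, ?_, ?_⟩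
  · have := (Nat.ceil_lt_add_one h0).le
    push_cast
    linarith
  · have h1 := Nat.le_ceil (T * L ^ (1 / p))
    have hN : (0 : ℝ) < ((⌈T * L ^ (1 / p)⌉₊ + 1 : ℕ) : ℝ) := by positivity
    have h2 : T * L ^ (1 / p) ≤ ((⌈T * L ^ (1 / p)⌉₊ + 1 : ℕ) : ℝ) := by
      push_cast
      linarith
    have h3 : L = (L ^ (1 / p)) ^ p := by
      rw [← Real.rpow_mul hL, one_div, inv_mul_cancel₀ hp.ne', Real.rpow_one]
    generalize ((⌈T * L ^ (1 / p)⌉₊ + 1 : ℕ) : ℝ) = N at *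
    calc L * (T / N) ^ p = (L ^ (1 / p) * (T / N)) ^ p := by
          rw [Real.mul_rpow (by positivity) (by positivity), ← h3]
      _ ≤ 1 := Real.rpow_le_one (by positivity) (by
          rw [← mul_div_assoc, div_le_one hN]; linarith) hp.le

lemma two_mul_half_rpow_le {h p θ : ℝ} (hh : 0 ≤ h) (hp : θ ≤ p) :
    2 * (h / 2) ^ p ≤ (2 : ℝ) ^ (1 - θ) * h ^ p := by
  have : 2 * (h / 2) ^ p = (2 : ℝ) ^ (1 - p) * h ^ p := by
    rw [Real.div_rpow hh (by norm_num), Real.rpow_sub (by norm_num), Real.rpow_one]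
    ring
  rw [this]
  gcongr
  norm_num

/-- A-priori Hölder estimate for solutions of Young differential equations. -/
lemma yde_holder_bound {V : Type*} [NormedAddCommGroup V]
    (α β : ℝ) (hα0 : 0 < α) (hα1 : α < 1) (hβ0 : 0 < β) (hβ1 : β < 1)
    (hαβ : 1 < α * (1 + β)) (T : ℝ) (hT : 0 < T) :
    ∃ C : ℝ, 0 ≤ C ∧ ∀ (A : ℝ → V → V) (x : ℝ → V) (M H K : ℝ), 0 ≤ M →
      (∀ s t : ℝ, ∀ z : V, 0 ≤ s → s ≤ t → t ≤ T → ‖A t z - A s z‖ ≤ M * (t - s) ^ α) →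
      (∀ s t : ℝ, ∀ z w : V, 0 ≤ s → s ≤ t → t ≤ T →
        ‖A t z - A s z - (A t w - A s w)‖ ≤ M * (t - s) ^ α * ‖z - w‖ ^ β) →
      (∀ s t : ℝ, 0 ≤ s → s ≤ t → t ≤ T → ‖x t - x s‖ ≤ H * (t - s) ^ α) →
      (∀ s t : ℝ, 0 ≤ s → s ≤ t → t ≤ T →
        ‖x t - x s - (A t (x s) - A s (x s))‖ ≤ K * (t - s) ^ (α * (1 + β))) →
      ∀ s t : ℝ, 0 ≤ s → s ≤ t → t ≤ T → ‖x t - x s‖ ≤ C * (1 + M ^ 2) * (t - s) ^ α := by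
  set c : ℝ := (1 - (2 : ℝ) ^ (1 - α * (1 + β)))⁻¹ with hc
  have hc0 : 0 ≤ c := by
    have : (2 : ℝ) ^ (1 - α * (1 + β)) < 1 :=
      Real.rpow_lt_one_of_one_lt_of_neg (by norm_num) (by linarith)
    exact inv_nonneg.2 (by linarith)
  have hp : 0 < α * β := by positivity
  refine ⟨4 * (T * (2 * c) ^ (1 / (α * β)) + 2), by positivity, ?_⟩
  intro A x M H K hM hA1 hA2 hx hsol
  obtain ⟨N, hN0, hN1, hN2⟩ := exists_subdivision T (2 * c * M) (α * β) hT (by positivity) hp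
  have hN' : (0 : ℝ) < N := by exact_mod_cast hN0
  have hloc : ∀ s t, 0 ≤ s → s ≤ t → t ≤ T → t - s ≤ T / N →
      ‖x t - x s‖ ≤ 2 * (M + 1 / 2) * (t - s) ^ α := by
    intro s t hs hst htT hh
    refine holder_absorb (fun s t => 0 ≤ s ∧ s ≤ t ∧ t ≤ T ∧ t - s ≤ T / N) x α H (M + 1 / 2)
      (by linarith) (fun s t h => h.2.1) (fun s t h => hx s t h.1 h.2.1 h.2.2.1) ?_ s t
      ⟨hs, hst, htT, hh⟩
    rintro Y hY hYb a b ⟨ha, hab, hbT, hba⟩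
    have hsew := sewing_estimate x (fun s t => A t (x s) - A s (x s))
      (fun h => M * Y ^ β * h ^ (α * (1 + β))) a b (α * (1 + β)) K hαβ
      (fun s t h1 h2 h3 => hsol s t (by linarith) h2 (by linarith)) ?_ ?_ a b le_rfl hab le_rfl
    · have hh0 : 0 ≤ b - a := by linarith
      have hg := hA1 a b (x a) ha hab hbT
      have htri : ‖x b - x a‖ ≤ ‖x b - x a - (A b (x a) - A a (x a))‖ + ‖A b (x a) - A a (x a)‖ :=
        norm_le_norm_sub_add _ _
      have hsplit : (b - a) ^ (α * (1 + β)) = (b - a) ^ α * (b - a) ^ (α * β) := by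
        rw [← Real.rpow_add_of_nonneg hh0 hα0.le hp.le]; ring_nf
      have hsm : 2 * c * M * (b - a) ^ (α * β) ≤ 1 :=
        le_trans (by gcongr) hN2
      have hYβ := rpow_le_one_add hY hβ0.le hβ1.le
      have hY0 : 0 ≤ Y ^ β := by positivity
      have hba0 : 0 ≤ (b - a) ^ α := by positivity
      have h1 : c * (M * Y ^ β * (b - a) ^ (α * (1 + β))) ≤ (1 / 2 + Y / 2) * (b - a) ^ α := by
        rw [hsplit]
        calc c * (M * Y ^ β * ((b - a) ^ α * (b - a) ^ (α * β)))
            = (2 * c * M * (b - a) ^ (α * β)) * (Y ^ β / 2 * (b - a) ^ α) := by ring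
          _ ≤ 1 * (Y ^ β / 2 * (b - a) ^ α) := by gcongr
          _ ≤ _ := by rw [one_mul]; gcongr; linarith
      calc _ ≤ _ := htri
        _ ≤ _ := add_le_add (hsew.trans h1) hg
        _ = _ := by ring
    · intro s u t h1 h2 h3 h4
      have e : A t (x s) - A s (x s) - (A u (x s) - A s (x s)) - (A t (x u) - A u (x u))
          = A t (x s) - A u (x s) - (A t (x u) - A u (x u)) := by abel
      have hts : 0 ≤ t - s := by linarith
      have htu : 0 ≤ t - u := by linarith
      have hus : 0 ≤ u - s := by linarith
      have hb := hYb s u ⟨by linarith, h2, by linarith, by linarith⟩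
      rw [norm_sub_rev] at hb
      simp only [e]
      calc _ ≤ _ := hA2 u t (x s) (x u) (by linarith) h3 (by linarith)
        _ ≤ M * (t - s) ^ α * (Y * (t - s) ^ α) ^ β := by
          gcongr
          exact hb.trans (by gcongr)
        _ = _ := by
          rw [Real.mul_rpow hY (by positivity), ← Real.rpow_mul hts,
            show α * (1 + β) = α + α * β by ring, Real.rpow_add_of_nonneg hts hα0.le hp.le]
          ring
    · intro h hh
      have := two_mul_half_rpow_le hh (le_refl (α * (1 + β)))
      have h0 : 0 ≤ M * Y ^ β := by positivity
      nlinarith [mul_le_mul_of_nonneg_left this h0]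
  intro s t hs hst htT
  refine (holder_of_local x α T _ N hN0 hloc s t hs hst htT).trans ?_
  have hts : 0 ≤ t - s := by linarith
  refine mul_le_mul_of_nonneg_right ?_ (by positivity)
  set C₁ := T * (2 * c) ^ (1 / (α * β)) + 2 with hC₁
  have hT0 : 0 ≤ T * (2 * c) ^ (1 / (α * β)) := by positivity
  have hC1 : 1 ≤ C₁ := by linarith
  have hM1 : 1 ≤ (1 + M) ^ (1 / (α * β)) := Real.one_le_rpow (by linarith) (by positivity)
  have hNle : (N : ℝ) ≤ C₁ * (1 + M) ^ (1 / (α * β)) := by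
    refine hN1.trans ?_
    rw [Real.mul_rpow (by positivity) hM, hC₁]
    have : M ^ (1 / (α * β)) ≤ (1 + M) ^ (1 / (α * β)) := by gcongr; linarith
    nlinarith [mul_le_mul_of_nonneg_left this hT0]
  have hNpow : (N : ℝ) ^ (1 - α) ≤ C₁ * (1 + M) := by
    calc (N : ℝ) ^ (1 - α) ≤ (C₁ * (1 + M) ^ (1 / (α * β))) ^ (1 - α) := by
          apply Real.rpow_le_rpow hN'.le hNle (by linarith)
      _ = C₁ ^ (1 - α) * (1 + M) ^ (1 / (α * β) * (1 - α)) := by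
          rw [Real.mul_rpow (by positivity) (by positivity), ← Real.rpow_mul (by positivity)]
      _ ≤ C₁ ^ (1 : ℝ) * (1 + M) ^ (1 : ℝ) := by
          gcongr
          · linarith
          · linarith
          · rw [one_div_mul_eq_div, div_le_one hp]; linarith
      _ = _ := by rw [Real.rpow_one, Real.rpow_one]
  calc (N : ℝ) ^ (1 - α) * (2 * (M + 1 / 2)) ≤ C₁ * (1 + M) * (2 * (M + 1 / 2)) := by gcongr
    _ ≤ 4 * C₁ * (1 + M ^ 2) := by
      have : (1 + M) * (2 * (M + 1 / 2)) ≤ 4 * (1 + M ^ 2) := by nlinarith [sq_nonneg (M - 1)]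
      nlinarith

/-- A-priori Hölder estimate for linear Young inequalities on short intervals. -/
lemma linear_young_local {V : Type*} [NormedAddCommGroup V]
    (α θ : ℝ) (hα0 : 0 < α) (hθ1 : 1 < θ) (hαθ : α < θ) (hθα : θ ≤ 2 * α) (T c : ℝ)
    (hc : c = (1 - (2 : ℝ) ^ (1 - θ))⁻¹) (hc0 : 0 ≤ c) (hT : 0 < T)
    (y : ℝ → V) (G : ℝ → ℝ → V) (M P F H K d : ℝ)
    (hM : 0 ≤ M) (hP : 0 ≤ P) (hF : 0 ≤ F)
    (hy : ∀ s t : ℝ, 0 ≤ s → s ≤ t → t ≤ T → ‖y t - y s‖ ≤ H * (t - s) ^ α)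
    (hR : ∀ s t : ℝ, 0 ≤ s → s ≤ t → t ≤ T → ‖y t - y s - G s t‖ ≤ K * (t - s) ^ θ)
    (hG : ∀ s t : ℝ, 0 ≤ s → s ≤ t → t ≤ T → ‖G s t‖ ≤ (M * ‖y s‖ + P) * (t - s) ^ α)
    (hδ : ∀ s u t : ℝ, 0 ≤ s → s ≤ u → u ≤ t → t ≤ T →
      ‖G s t - G s u - G u t‖ ≤ M * (t - u) ^ α * ‖y u - y s‖ + F * (t - s) ^ θ)
    (hd : 2 * (c + 1) * M * d ^ α ≤ 1)
    (a b : ℝ) (ha : 0 ≤ a) (hab : a ≤ b) (hbT : b ≤ T) (hba : b - a ≤ d) :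
    ‖y b - y a‖ ≤ 2 * (M * ‖y a‖ + (P + c * F * T ^ (θ - α))) * (b - a) ^ α := by
  have hsplit : ∀ h p q : ℝ, 0 ≤ h → 0 ≤ p → 0 ≤ q → h ^ (p + q) = h ^ p * h ^ q :=
    fun h p q hh hp hq => Real.rpow_add_of_nonneg hh hp hq
  refine holder_absorb (fun s t => a ≤ s ∧ s ≤ t ∧ t ≤ b) y α H (M * ‖y a‖ + (P + c * F * T ^ (θ - α)))
    (by positivity) (fun s t h => h.2.1)
    (fun s t h => hy s t (by linarith [h.1]) h.2.1 (by linarith [h.2.2])) ?_ a b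
    ⟨le_rfl, hab, le_rfl⟩
  rintro Y hY hYb s t ⟨has, hst, htb⟩
  have hts : 0 ≤ t - s := by linarith
  have hsew := sewing_estimate y G (fun h => M * Y * h ^ (2 * α) + F * h ^ θ) a b θ K hθ1
    (fun s t h1 h2 h3 => hR s t (by linarith) h2 (by linarith)) ?_ ?_ s t has hst htb
  · rw [← hc] at hsew
    have htri : ‖y t - y s‖ ≤ ‖y t - y s - G s t‖ + ‖G s t‖ := norm_le_norm_sub_add _ _
    have hg := hG s t (by linarith) hst (by linarith)
    have hys : ‖y s‖ ≤ ‖y a‖ + Y * (b - a) ^ α := by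
      have h1 := hYb a s ⟨le_rfl, has, by linarith⟩
      have h2 : ‖y s‖ ≤ ‖y s - y a‖ + ‖y a‖ := norm_le_norm_sub_add _ _
      have h3 : (s - a) ^ α ≤ (b - a) ^ α := by gcongr; linarith
      nlinarith [mul_le_mul_of_nonneg_left h3 hY]
    have hsm : 2 * (c + 1) * M * (b - a) ^ α ≤ 1 := le_trans (by gcongr) hd
    have hts0 : 0 ≤ (t - s) ^ α := by positivity
    have e1 : (t - s) ^ (2 * α) ≤ (t - s) ^ α * (b - a) ^ α := by
      rw [two_mul, hsplit _ _ _ hts hα0.le hα0.le]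
      gcongr
    have e2 : (t - s) ^ θ ≤ (t - s) ^ α * T ^ (θ - α) := by
      rw [show θ = α + (θ - α) by ring, hsplit _ _ _ hts hα0.le (by linarith)]
      have : (t - s) ^ (θ - α) ≤ T ^ (θ - α) :=
        Real.rpow_le_rpow hts (by linarith) (by linarith)
      rw [show α + (θ - α) - α = θ - α by ring]
      gcongr
    calc ‖y t - y s‖ ≤ c * (M * Y * ((t - s) ^ α * (b - a) ^ α)
            + F * ((t - s) ^ α * T ^ (θ - α)))
            + (M * (‖y a‖ + Y * (b - a) ^ α) + P) * (t - s) ^ α := by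
          refine htri.trans (add_le_add (hsew.trans ?_) (hg.trans ?_)) <;> gcongr
      _ = (M * ‖y a‖ + (P + c * F * T ^ (θ - α)) + 2 * (c + 1) * M * (b - a) ^ α * (Y / 2))
            * (t - s) ^ α := by
          ring
      _ ≤ (M * ‖y a‖ + (P + c * F * T ^ (θ - α)) + 1 * (Y / 2)) * (t - s) ^ α := by gcongr
      _ = _ := by ring
  · intro s u t h1 h2 h3 h4
    have hts : 0 ≤ t - s := by linarith
    refine (hδ s u t (by linarith) h2 h3 (by linarith)).trans ?_
    have hb := hYb s u ⟨h1, h2, by linarith⟩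
    have h5 : (t - u) ^ α ≤ (t - s) ^ α := by gcongr
    have h6 : (u - s) ^ α ≤ (t - s) ^ α := by gcongr
    have h7 : ‖y u - y s‖ ≤ Y * (t - s) ^ α := hb.trans (by gcongr)
    rw [two_mul, hsplit _ _ _ hts hα0.le hα0.le]
    have h8 : M * (t - u) ^ α * ‖y u - y s‖ ≤ M * (t - s) ^ α * (Y * (t - s) ^ α) := by
      gcongr
    nlinarith
  · intro h hh
    have i1 := two_mul_half_rpow_le hh hθα
    have i2 := two_mul_half_rpow_le hh (le_refl θ)
    have h0 : 0 ≤ M * Y := by positivity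
    nlinarith [mul_le_mul_of_nonneg_left i1 h0, mul_le_mul_of_nonneg_left i2 hF]

/-- Linear Young–Gronwall inequality on `[0, T]`. -/
lemma young_gronwall {V : Type*} [NormedAddCommGroup V]
    (α θ : ℝ) (hα0 : 0 < α) (hα1 : α < 1) (hθ1 : 1 < θ) (hαθ : α < θ) (hθα : θ ≤ 2 * α)
    (T : ℝ) (hT : 0 < T) :
    ∃ C : ℝ, 0 ≤ C ∧ ∀ (y : ℝ → V) (G : ℝ → ℝ → V) (M P F H K : ℝ),
      0 ≤ M → 0 ≤ P → 0 ≤ F →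
      (∀ s t : ℝ, 0 ≤ s → s ≤ t → t ≤ T → ‖y t - y s‖ ≤ H * (t - s) ^ α) →
      (∀ s t : ℝ, 0 ≤ s → s ≤ t → t ≤ T → ‖y t - y s - G s t‖ ≤ K * (t - s) ^ θ) →
      (∀ s t : ℝ, 0 ≤ s → s ≤ t → t ≤ T → ‖G s t‖ ≤ (M * ‖y s‖ + P) * (t - s) ^ α) →
      (∀ s u t : ℝ, 0 ≤ s → s ≤ u → u ≤ t → t ≤ T →
        ‖G s t - G s u - G u t‖ ≤ M * (t - u) ^ α * ‖y u - y s‖ + F * (t - s) ^ θ) →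
      (∀ t : ℝ, 0 ≤ t → t ≤ T →
        ‖y t‖ ≤ C * Real.exp (C * M ^ (1 / α)) * (‖y 0‖ + (P + F))) ∧
      (∀ s t : ℝ, 0 ≤ s → s ≤ t → t ≤ T →
        ‖y t - y s‖ ≤ C * Real.exp (C * M ^ (1 / α)) * (‖y 0‖ + (P + F)) * (t - s) ^ α) := by
  set c : ℝ := (1 - (2 : ℝ) ^ (1 - θ))⁻¹ with hc
  have hc0 : 0 ≤ c := by
    have : (2 : ℝ) ^ (1 - θ) < 1 :=
      Real.rpow_lt_one_of_one_lt_of_neg (by norm_num) (by linarith)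
    exact inv_nonneg.2 (by linarith)
  set C₃ : ℝ := T * (2 * (c + 1)) ^ (1 / α) with hC₃
  set C₂ : ℝ := 1 + c * T ^ (θ - α) with hC₂
  set C₄ : ℝ := Real.exp 4 * (4 * (1 + 2 * T ^ α * C₂) + 4 * C₂) with hC₄
  have hC₃0 : 0 ≤ C₃ := by positivity
  have hC₂0 : 0 ≤ C₂ := by positivity
  have hC₄0 : 0 ≤ C₄ := by positivity
  refine ⟨C₄ + 2 * C₃ + 1, by positivity, ?_⟩
  intro y G M P F H K hM hP hF hy hR hG hδ
  obtain ⟨N, hN0, hN1, hN2⟩ :=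
    exists_subdivision T (2 * (c + 1) * M) α hT (by positivity) hα0
  have hN' : (0 : ℝ) < N := by exact_mod_cast hN0
  have hN1' : (1 : ℝ) ≤ N := by exact_mod_cast hN0
  set E : ℝ := P + c * F * T ^ (θ - α) with hE
  have hE0 : 0 ≤ E := by positivity
  have hloc : ∀ a b, 0 ≤ a → a ≤ b → b ≤ T → b - a ≤ T / N →
      ‖y b - y a‖ ≤ 2 * (M * ‖y a‖ + E) * (b - a) ^ α :=
    linear_young_local α θ hα0 hθ1 hαθ hθα T c hc hc0 hT y G M P F H K (T / N) hM hP hF hy hR hG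
      hδ hN2
  have hMh : 2 * M * (T / N) ^ α ≤ 1 := by
    have h0 : 0 ≤ c * M * (T / N) ^ α := by positivity
    linarith
  set R : ℝ := 2 * E * T ^ α with hRdef
  have hR0 : 0 ≤ R := by positivity
  have hsup : ∀ k : ℕ, ∀ t, 0 ≤ t → t ≤ T → t ≤ k * (T / N) →
      ‖y t‖ ≤ 2 ^ k * (‖y 0‖ + R) - R := by
    intro k
    induction k with
    | zero =>
      intro t h0 _ h1
      have : t = 0 := by
        simp only [Nat.cast_zero, zero_mul] at h1
        linarith
      simp [this]
    | succ k ih =>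
      intro t h0 hTt h1
      push_cast at h1
      have hTN : 0 ≤ T / N := by positivity
      have hkN : 0 ≤ (k : ℝ) * (T / N) := by positivity
      set a := max 0 (t - T / N)
      have ha0 : 0 ≤ a := le_max_left _ _
      have hat : a ≤ t := max_le h0 (by linarith)
      have hta : t - a ≤ T / N := by linarith [le_max_right 0 (t - T / N)]
      have hya := ih a ha0 (by linarith) (max_le hkN (by linarith))
      have hl := hloc a t ha0 hat hTt hta
      have htri : ‖y t‖ ≤ ‖y t - y a‖ + ‖y a‖ := norm_le_norm_sub_add _ _
      have h3 : (t - a) ^ α ≤ T ^ α := by gcongr; linarith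
      have h4 : 2 * M * (t - a) ^ α ≤ 1 := le_trans (by gcongr) hMh
      have h5 : ‖y t‖ ≤ 2 * ‖y a‖ + R := by
        have := mul_le_mul_of_nonneg_right h4 (norm_nonneg (y a))
        have := mul_le_mul_of_nonneg_left h3 hE0
        nlinarith
      rw [pow_succ]
      linarith
  set m : ℝ := M ^ (1 / α) with hm
  have hm0 : 0 ≤ m := by positivity
  set Z : ℝ := ‖y 0‖ + (P + F) with hZ
  have hZ0 : 0 ≤ Z := by positivity
  have hEZ : E ≤ C₂ * Z := by
    have h1 : 0 ≤ c * T ^ (θ - α) := by positivity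
    have h2 := norm_nonneg (y 0)
    rw [hE, hC₂, hZ]
    linarith [mul_nonneg h1 h2, mul_nonneg h1 hP]
  have hNm : (N : ℝ) ≤ C₃ * m + 2 := by
    refine hN1.trans (le_of_eq ?_)
    rw [Real.mul_rpow (by positivity) hM]
    ring
  set e : ℝ := Real.exp (C₃ * m + 2) with he
  have he1 : 1 ≤ e := Real.one_le_exp (by positivity)
  have h2N : (2 : ℝ) ^ N ≤ e := by
    calc (2 : ℝ) ^ N ≤ (Real.exp 1) ^ N := by
          gcongr
          linarith [Real.add_one_le_exp 1]
      _ = Real.exp N := by rw [← Real.exp_nat_mul, mul_one]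
      _ ≤ e := Real.exp_le_exp.2 hNm
  have hS : ∀ t, 0 ≤ t → t ≤ T → ‖y t‖ ≤ e * (1 + 2 * T ^ α * C₂) * Z := by
    intro t h0 h1
    have h2 := hsup N t h0 h1 (by rw [mul_div_cancel₀ _ hN'.ne']; exact h1)
    have h3 : ‖y 0‖ + R ≤ (1 + 2 * T ^ α * C₂) * Z := by
      have h4 : 0 ≤ T ^ α := by positivity
      have h5 : ‖y 0‖ ≤ Z := by rw [hZ]; linarith
      have h6 : R ≤ 2 * (C₂ * Z) * T ^ α := by rw [hRdef]; gcongr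
      linarith
    calc ‖y t‖ ≤ 2 ^ N * (‖y 0‖ + R) := by linarith
      _ ≤ e * ((1 + 2 * T ^ α * C₂) * Z) := by gcongr
      _ = _ := by ring
  have hNe : (N : ℝ) ≤ e := by
    have := Real.add_one_le_exp (C₃ * m + 2)
    linarith
  have hMm : 1 + M ≤ 2 * Real.exp m := by
    have h1 : M = m ^ α := by
      rw [hm, ← Real.rpow_mul hM, one_div, inv_mul_cancel₀ hα0.ne', Real.rpow_one]
    have h2 := rpow_le_one_add hm0 hα0.le hα1.le
    have h3 := Real.add_one_le_exp m
    linarith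
  have hee : e * e * Real.exp m = Real.exp 4 * Real.exp ((2 * C₃ + 1) * m) := by
    rw [he, ← Real.exp_add, ← Real.exp_add, ← Real.exp_add]
    ring_nf
  have hbig : Real.exp 4 * Real.exp ((2 * C₃ + 1) * m) * (4 * (1 + 2 * T ^ α * C₂) + 4 * C₂) * Z
      ≤ (C₄ + 2 * C₃ + 1) * Real.exp ((C₄ + 2 * C₃ + 1) * m) * Z := by
    have h1 : Real.exp ((2 * C₃ + 1) * m) ≤ Real.exp ((C₄ + 2 * C₃ + 1) * m) := by
      gcongr
      linarith
    calc _ = C₄ * Real.exp ((2 * C₃ + 1) * m) * Z := by rw [hC₄]; ring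
      _ ≤ _ := by
        gcongr
        linarith
  have hexpm : 1 ≤ Real.exp m := Real.one_le_exp hm0
  constructor
  · intro t h0 h1
    refine (hS t h0 h1).trans (le_trans ?_ hbig)
    rw [← hee]
    have h2 : e ≤ e * e * Real.exp m := by
      have : e * 1 * 1 ≤ e * e * Real.exp m := by gcongr
      linarith
    have h3 : 0 ≤ 1 + 2 * T ^ α * C₂ := by positivity
    have h4 : 1 + 2 * T ^ α * C₂ ≤ 4 * (1 + 2 * T ^ α * C₂) + 4 * C₂ := by linarith
    exact mul_le_mul_of_nonneg_right (mul_le_mul h2 h4 h3 (by positivity)) hZ0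
  · intro s t hs hst htT
    have hh := holder_of_local y α T (2 * (M * (e * (1 + 2 * T ^ α * C₂) * Z) + C₂ * Z)) N hN0
      (fun a b h1 h2 h3 h4 => (hloc a b h1 h2 h3 h4).trans (by
        have h5 := hS a h1 (by linarith)
        have : 0 ≤ b - a := by linarith
        gcongr)) s t hs hst htT
    refine hh.trans ?_
    have hts : 0 ≤ t - s := by linarith
    refine mul_le_mul_of_nonneg_right (le_trans ?_ hbig) (by positivity)
    rw [← hee]
    have h6 : (N : ℝ) ^ (1 - α) ≤ e := by
      calc (N : ℝ) ^ (1 - α) ≤ (N : ℝ) ^ (1 : ℝ) :=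
            Real.rpow_le_rpow_of_exponent_le hN1' (by linarith)
        _ ≤ e := by rw [Real.rpow_one]; exact hNe
    have h7 : 2 * (M * (e * (1 + 2 * T ^ α * C₂) * Z) + C₂ * Z)
        ≤ 2 * ((1 + M) * (e * ((1 + 2 * T ^ α * C₂) + C₂) * Z)) := by
      have i1 : 0 ≤ e * (1 + 2 * T ^ α * C₂) * Z := by positivity
      have i2 : 0 ≤ M * (e * C₂ * Z) := by positivity
      have i3 : 0 ≤ (e - 1) * (C₂ * Z) := mul_nonneg (by linarith) (by positivity)
      linarith
    calc _ ≤ e * (2 * ((2 * Real.exp m) * (e * ((1 + 2 * T ^ α * C₂) + C₂) * Z))) := by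
          refine mul_le_mul h6 (h7.trans ?_) (by positivity) (by positivity)
          gcongr
      _ = _ := by ring


/-- **Conditional Comparison Principle via averaged translations.**  Let `α(1+β) > 1`,
`A¹, A² ∈ C^α_t C^β_V`, and `x¹, x²` solutions of the respective YDEs.  If the averaged
translation `B = τ_{x¹}A¹` belongs to `C^α_t Lip_V`, then
`‖x¹ - x²‖_α ≤ C exp(C ‖B‖_{α,1}^{1/α}) (1 + ‖A²‖_{α,β}²)(‖x¹_0 - x²_0‖ + ‖A¹ - A²‖_{α,β})`
with `C = C(α,β,T)`; in particular `x¹` is the unique `C^α` solution of the YDE associated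
to `(x¹_0, A¹)`. -/
theorem conditional_comparison_principle
    {V : Type*} [NormedAddCommGroup V] [NormedSpace ℝ V]
    (α β : ℝ) (hα0 : 0 < α) (hα1 : α < 1) (hβ0 : 0 < β) (hβ1 : β < 1)
    (hαβ : 1 < α * (1 + β)) (T : ℝ) (hT : 0 < T) :
    ∃ C : ℝ, 0 ≤ C ∧
      ∀ (A₁ A₂ B : ℝ → V → V) (x₁ x₂ : ℝ → V) (M₁ M₂ MB D K₁ K₂ κ₀ : ℝ),
        (∀ z : V, A₁ 0 z = 0) → (∀ z : V, A₂ 0 z = 0) → (∀ z : V, B 0 z = 0) →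
        0 ≤ MB →
        -- ‖A₁‖_{α,β} ≤ M₁, ‖A₂‖_{α,β} ≤ M₂
        (∀ s t : ℝ, ∀ z : V, 0 ≤ s → s ≤ t → t ≤ T →
          ‖A₁ t z - A₁ s z‖ ≤ M₁ * (t - s) ^ α) →
        (∀ s t : ℝ, ∀ z w : V, 0 ≤ s → s ≤ t → t ≤ T →
          ‖A₁ t z - A₁ s z - (A₁ t w - A₁ s w)‖ ≤ M₁ * (t - s) ^ α * ‖z - w‖ ^ β) →
        (∀ s t : ℝ, ∀ z : V, 0 ≤ s → s ≤ t → t ≤ T →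
          ‖A₂ t z - A₂ s z‖ ≤ M₂ * (t - s) ^ α) →
        (∀ s t : ℝ, ∀ z w : V, 0 ≤ s → s ≤ t → t ≤ T →
          ‖A₂ t z - A₂ s z - (A₂ t w - A₂ s w)‖ ≤ M₂ * (t - s) ^ α * ‖z - w‖ ^ β) →
        -- ‖B‖_{α,1} ≤ MB : B ∈ C^α_t Lip_V
        (∀ s t : ℝ, ∀ z : V, 0 ≤ s → s ≤ t → t ≤ T →
          ‖B t z - B s z‖ ≤ MB * (t - s) ^ α) →
        (∀ s t : ℝ, ∀ z w : V, 0 ≤ s → s ≤ t → t ≤ T →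
          ‖B t z - B s z - (B t w - B s w)‖ ≤ MB * (t - s) ^ α * ‖z - w‖) →
        -- B is the averaged translation τ_{x¹}A¹
        (∀ s t : ℝ, ∀ z : V, 0 ≤ s → s ≤ t → t ≤ T →
          ‖B t z - B s z - (A₁ t (z + x₁ s) - A₁ s (z + x₁ s))‖ ≤
            κ₀ * (t - s) ^ (α * (1 + β))) →
        -- ‖A₁ - A₂‖_{α,β} ≤ D
        (∀ s t : ℝ, ∀ z : V, 0 ≤ s → s ≤ t → t ≤ T →
          ‖(A₁ t z - A₂ t z) - (A₁ s z - A₂ s z)‖ ≤ D * (t - s) ^ α) →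
        (∀ s t : ℝ, ∀ z w : V, 0 ≤ s → s ≤ t → t ≤ T →
          ‖(A₁ t z - A₂ t z) - (A₁ s z - A₂ s z) -
              ((A₁ t w - A₂ t w) - (A₁ s w - A₂ s w))‖ ≤ D * (t - s) ^ α * ‖z - w‖ ^ β) →
        -- x₁, x₂ are solutions
        (∀ s t : ℝ, 0 ≤ s → s ≤ t → t ≤ T → ‖x₁ t - x₁ s‖ ≤ K₁ * (t - s) ^ α) →
        (∀ s t : ℝ, 0 ≤ s → s ≤ t → t ≤ T → ‖x₂ t - x₂ s‖ ≤ K₂ * (t - s) ^ α) →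
        (∃ K : ℝ, ∀ s t : ℝ, 0 ≤ s → s ≤ t → t ≤ T →
          ‖x₁ t - x₁ s - (A₁ t (x₁ s) - A₁ s (x₁ s))‖ ≤ K * (t - s) ^ (α * (1 + β))) →
        (∃ K : ℝ, ∀ s t : ℝ, 0 ≤ s → s ≤ t → t ≤ T →
          ‖x₂ t - x₂ s - (A₂ t (x₂ s) - A₂ s (x₂ s))‖ ≤ K * (t - s) ^ (α * (1 + β))) →
        -- comparison estimate (sup part and Hölder part of ‖x₁ - x₂‖_α)
        ((∀ t : ℝ, 0 ≤ t → t ≤ T →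
          ‖x₁ t - x₂ t‖ ≤
            C * Real.exp (C * MB ^ (1 / α)) * (1 + M₂ ^ 2) * (‖x₁ 0 - x₂ 0‖ + D)) ∧
        (∀ s t : ℝ, 0 ≤ s → s ≤ t → t ≤ T →
          ‖(x₁ t - x₂ t) - (x₁ s - x₂ s)‖ ≤
            C * Real.exp (C * MB ^ (1 / α)) * (1 + M₂ ^ 2) * (‖x₁ 0 - x₂ 0‖ + D) *
              (t - s) ^ α) ∧
        -- uniqueness of x₁ among C^α solutions of the YDE associated to (x₁ 0, A₁)
        (∀ (y : ℝ → V) (Ky K' : ℝ), y 0 = x₁ 0 →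
          (∀ s t : ℝ, 0 ≤ s → s ≤ t → t ≤ T → ‖y t - y s‖ ≤ Ky * (t - s) ^ α) →
          (∀ s t : ℝ, 0 ≤ s → s ≤ t → t ≤ T →
            ‖y t - y s - (A₁ t (y s) - A₁ s (y s))‖ ≤ K' * (t - s) ^ (α * (1 + β))) →
          ∀ t : ℝ, 0 ≤ t → t ≤ T → y t = x₁ t)) := by
  have hαβ' : α * β < α := by nlinarith
  obtain ⟨Cx, hCx0, hCx⟩ := yde_holder_bound (V := V) α β hα0 hα1 hβ0 hβ1 hαβ T hT
  obtain ⟨Cg, hCg0, hCg⟩ := young_gronwall (V := V) α (α * (1 + β)) hα0 hα1 hαβ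
    (by nlinarith) (by nlinarith) T hT
  refine ⟨Cg * (Cx + 2) + Cg, by positivity, ?_⟩
  have main : ∀ (A₁ A₂ B : ℝ → V → V) (x₁ x₂ : ℝ → V) (M₂ MB D K₁ K₂ κ₀ : ℝ), 0 ≤ MB →
      (∀ s t : ℝ, ∀ z : V, 0 ≤ s → s ≤ t → t ≤ T → ‖A₂ t z - A₂ s z‖ ≤ M₂ * (t - s) ^ α) →
      (∀ s t : ℝ, ∀ z w : V, 0 ≤ s → s ≤ t → t ≤ T →
        ‖A₂ t z - A₂ s z - (A₂ t w - A₂ s w)‖ ≤ M₂ * (t - s) ^ α * ‖z - w‖ ^ β) →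
      (∀ s t : ℝ, ∀ z w : V, 0 ≤ s → s ≤ t → t ≤ T →
        ‖B t z - B s z - (B t w - B s w)‖ ≤ MB * (t - s) ^ α * ‖z - w‖) →
      (∀ s t : ℝ, ∀ z : V, 0 ≤ s → s ≤ t → t ≤ T →
        ‖B t z - B s z - (A₁ t (z + x₁ s) - A₁ s (z + x₁ s))‖ ≤
          κ₀ * (t - s) ^ (α * (1 + β))) →
      (∀ s t : ℝ, ∀ z : V, 0 ≤ s → s ≤ t → t ≤ T →
        ‖(A₁ t z - A₂ t z) - (A₁ s z - A₂ s z)‖ ≤ D * (t - s) ^ α) →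
      (∀ s t : ℝ, ∀ z w : V, 0 ≤ s → s ≤ t → t ≤ T →
        ‖(A₁ t z - A₂ t z) - (A₁ s z - A₂ s z) -
            ((A₁ t w - A₂ t w) - (A₁ s w - A₂ s w))‖ ≤ D * (t - s) ^ α * ‖z - w‖ ^ β) →
      (∀ s t : ℝ, 0 ≤ s → s ≤ t → t ≤ T → ‖x₁ t - x₁ s‖ ≤ K₁ * (t - s) ^ α) →
      (∀ s t : ℝ, 0 ≤ s → s ≤ t → t ≤ T → ‖x₂ t - x₂ s‖ ≤ K₂ * (t - s) ^ α) →
      (∃ K : ℝ, ∀ s t : ℝ, 0 ≤ s → s ≤ t → t ≤ T →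
        ‖x₁ t - x₁ s - (A₁ t (x₁ s) - A₁ s (x₁ s))‖ ≤ K * (t - s) ^ (α * (1 + β))) →
      (∃ K : ℝ, ∀ s t : ℝ, 0 ≤ s → s ≤ t → t ≤ T →
        ‖x₂ t - x₂ s - (A₂ t (x₂ s) - A₂ s (x₂ s))‖ ≤ K * (t - s) ^ (α * (1 + β))) →
      (∀ t : ℝ, 0 ≤ t → t ≤ T →
        ‖x₁ t - x₂ t‖ ≤ (Cg * (Cx + 2) + Cg) * Real.exp ((Cg * (Cx + 2) + Cg) * MB ^ (1 / α)) *
          (1 + M₂ ^ 2) * (‖x₁ 0 - x₂ 0‖ + D)) ∧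
      (∀ s t : ℝ, 0 ≤ s → s ≤ t → t ≤ T →
        ‖(x₁ t - x₂ t) - (x₁ s - x₂ s)‖ ≤
          (Cg * (Cx + 2) + Cg) * Real.exp ((Cg * (Cx + 2) + Cg) * MB ^ (1 / α)) *
            (1 + M₂ ^ 2) * (‖x₁ 0 - x₂ 0‖ + D) * (t - s) ^ α) := by
    intro A₁ A₂ B x₁ x₂ M₂ MB D K₁ K₂ κ₀ hMB hA1 hA2 hB hτ hD1 hD2 hx1 hx2 hs1 hs2
    obtain ⟨L₁, hs1⟩ := hs1
    obtain ⟨L₂, hs2⟩ := hs2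
    have hTα : 0 < (T - 0) ^ α := by rw [sub_zero]; positivity
    have hM₂ : 0 ≤ M₂ :=
      nonneg_of_mul_nonneg_left ((norm_nonneg _).trans (hA1 0 T 0 le_rfl hT.le le_rfl)) hTα
    have hD : 0 ≤ D :=
      nonneg_of_mul_nonneg_left ((norm_nonneg _).trans (hD1 0 T 0 le_rfl hT.le le_rfl)) hTα
    set X : ℝ := Cx * (1 + M₂ ^ 2) with hX
    have hX0 : 0 ≤ X := by positivity
    have hx2X := hCx A₂ x₂ M₂ K₂ L₂ hM₂ hA1 hA2 hx2 hs2
    obtain ⟨hsup, hhol⟩ := hCg (fun t => x₂ t - x₁ t)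
      (fun s t => (B t (x₂ s - x₁ s) - B s (x₂ s - x₁ s) - (B t 0 - B s 0))
        - ((A₁ t (x₂ s) - A₂ t (x₂ s)) - (A₁ s (x₂ s) - A₂ s (x₂ s))))
      MB D (D * X ^ β) (K₁ + K₂) (L₁ + L₂ + 2 * κ₀) hMB hD (by positivity)
      (by
        intro s t h1 h2 h3
        have e : x₂ t - x₁ t - (x₂ s - x₁ s) = (x₂ t - x₂ s) - (x₁ t - x₁ s) := by abel
        simp only [e]
        refine (norm_sub_le _ _).trans ?_
        linarith [hx1 s t h1 h2 h3, hx2 s t h1 h2 h3])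
      (by
        intro s t h1 h2 h3
        have j1 := hs1 s t h1 h2 h3
        have j2 := hs2 s t h1 h2 h3
        have j3 := hτ s t 0 h1 h2 h3
        have j4 := hτ s t (x₂ s - x₁ s) h1 h2 h3
        rw [zero_add] at j3
        rw [sub_add_cancel] at j4
        have e : x₂ t - x₁ t - (x₂ s - x₁ s) -
            ((B t (x₂ s - x₁ s) - B s (x₂ s - x₁ s) - (B t 0 - B s 0))
              - ((A₁ t (x₂ s) - A₂ t (x₂ s)) - (A₁ s (x₂ s) - A₂ s (x₂ s))))
            = ((x₂ t - x₂ s - (A₂ t (x₂ s) - A₂ s (x₂ s)))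
              - (x₁ t - x₁ s - (A₁ t (x₁ s) - A₁ s (x₁ s))))
              + ((B t 0 - B s 0 - (A₁ t (x₁ s) - A₁ s (x₁ s)))
              - (B t (x₂ s - x₁ s) - B s (x₂ s - x₁ s) - (A₁ t (x₂ s) - A₁ s (x₂ s)))) := by
          abel
        simp only [e]
        refine (norm_add_le _ _).trans ((add_le_add (norm_sub_le _ _) (norm_sub_le _ _)).trans ?_)
        linarith)
      (by
        intro s t h1 h2 h3
        refine (norm_sub_le _ _).trans ?_
        have j1 := hB s t (x₂ s - x₁ s) 0 h1 h2 h3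
        rw [sub_zero] at j1
        linarith [hD1 s t (x₂ s) h1 h2 h3])
      (by
        intro s u t h1 h2 h3 h4
        have hts : 0 ≤ t - s := by linarith
        have htu : 0 ≤ t - u := by linarith
        have hus : 0 ≤ u - s := by linarith
        have e : ∀ z w z' w' : V,
            (B t z - B s z - (B t 0 - B s 0)) - ((A₁ t w - A₂ t w) - (A₁ s w - A₂ s w))
            - ((B u z - B s z - (B u 0 - B s 0)) - ((A₁ u w - A₂ u w) - (A₁ s w - A₂ s w)))
            - ((B t z' - B u z' - (B t 0 - B u 0)) - ((A₁ t w' - A₂ t w') - (A₁ u w' - A₂ u w')))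
            = (B t z - B u z - (B t z' - B u z'))
              - ((A₁ t w - A₂ t w) - (A₁ u w - A₂ u w)
                - ((A₁ t w' - A₂ t w') - (A₁ u w' - A₂ u w'))) := by
          intro z w z' w'; abel
        simp only [e]
        refine (norm_sub_le _ _).trans (add_le_add ?_ ?_)
        · rw [norm_sub_rev (x₂ u - x₁ u)]
          exact hB u t _ _ (by linarith) h3 h4
        · have hb := hx2X s u h1 h2 (by linarith)
          rw [norm_sub_rev] at hb
          calc _ ≤ _ := hD2 u t (x₂ s) (x₂ u) (by linarith) h3 h4
            _ ≤ D * (t - s) ^ α * (X * (t - s) ^ α) ^ β := by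
              gcongr
              exact hb.trans (by gcongr)
            _ = _ := by
              rw [Real.mul_rpow hX0 (by positivity), ← Real.rpow_mul hts,
                show α * (1 + β) = α + α * β by ring,
                Real.rpow_add_of_nonneg hts hα0.le (by positivity)]
              ring)
    set m : ℝ := MB ^ (1 / α)
    have hm0 : 0 ≤ m := by positivity
    have hconst : Cg * Real.exp (Cg * m) * (‖x₂ 0 - x₁ 0‖ + (D + D * X ^ β)) ≤
        (Cg * (Cx + 2) + Cg) * Real.exp ((Cg * (Cx + 2) + Cg) * m) *
          (1 + M₂ ^ 2) * (‖x₁ 0 - x₂ 0‖ + D) := by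
      rw [norm_sub_rev (x₂ 0)]
      have i0 : 0 ≤ Cg * (Cx + 2) := by positivity
      have i1 : Real.exp (Cg * m) ≤ Real.exp ((Cg * (Cx + 2) + Cg) * m) := by
        gcongr
        linarith
      have i2 : X ^ β ≤ 1 + X := rpow_le_one_add hX0 hβ0.le hβ1.le
      have i3 : ‖x₁ 0 - x₂ 0‖ + (D + D * X ^ β) ≤
          (Cx + 2) * ((1 + M₂ ^ 2) * (‖x₁ 0 - x₂ 0‖ + D)) := by
        have k0 := norm_nonneg (x₁ 0 - x₂ 0)
        have k1 : D * X ^ β ≤ D * (1 + X) := by gcongr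
        have k2 : 1 + X + 1 ≤ (Cx + 2) * (1 + M₂ ^ 2) := by
          rw [hX]
          nlinarith [sq_nonneg M₂]
        have k3 := mul_le_mul_of_nonneg_right k2 (add_nonneg k0 hD)
        nlinarith [mul_nonneg hX0 k0]
      have i4 : 0 ≤ (1 + M₂ ^ 2) * (‖x₁ 0 - x₂ 0‖ + D) := by positivity
      calc _ ≤ Cg * Real.exp ((Cg * (Cx + 2) + Cg) * m) *
            ((Cx + 2) * ((1 + M₂ ^ 2) * (‖x₁ 0 - x₂ 0‖ + D))) := by gcongr
        _ = (Cg * (Cx + 2)) * Real.exp ((Cg * (Cx + 2) + Cg) * m) *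
            ((1 + M₂ ^ 2) * (‖x₁ 0 - x₂ 0‖ + D)) := by ring
        _ ≤ (Cg * (Cx + 2) + Cg) * Real.exp ((Cg * (Cx + 2) + Cg) * m) *
            ((1 + M₂ ^ 2) * (‖x₁ 0 - x₂ 0‖ + D)) := by
          gcongr
          linarith
        _ = _ := by ring
    constructor
    · intro t h1 h2
      rw [norm_sub_rev]
      exact (hsup t h1 h2).trans hconst
    · intro s t h1 h2 h3
      have e : x₁ t - x₂ t - (x₁ s - x₂ s) = -(x₂ t - x₁ t - (x₂ s - x₁ s)) := by abel
      rw [e, norm_neg]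
      have hts : 0 ≤ t - s := by linarith
      exact (hhol s t h1 h2 h3).trans (by gcongr)
  intro A₁ A₂ B x₁ x₂ M₁ M₂ MB D K₁ K₂ κ₀ _ _ _ hMB hA1 hA1' hA2 hA2' _ hB hτ hD1 hD2 hx1 hx2
    hs1 hs2
  obtain ⟨h1, h2⟩ := main A₁ A₂ B x₁ x₂ M₂ MB D K₁ K₂ κ₀ hMB hA2 hA2' hB hτ hD1 hD2 hx1 hx2 hs1
    hs2
  refine ⟨h1, h2, ?_⟩
  intro y Ky K' hy0 hy hsy t ht0 htT
  have h := (main A₁ A₁ B x₁ y M₁ MB 0 K₁ Ky κ₀ hMB hA1 hA1' hB hτ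
    (by intros; simp) (by intros; simp) hx1 hy hs1 ⟨K', hsy⟩).1 t ht0 htT
  rw [hy0, sub_self, norm_zero, add_zero, mul_zero] at h
  exact (sub_eq_zero.1 (norm_le_zero_iff.1 h)).symm
end

section
/- Commutator lemma: Fix d ≥ 1, β ∈ (0,1), and a mollifier ρ ∈ C_c^∞(ℝ^d) with ρ ≥ 0, supp ρ ⊆ B₁ and ∫ρ = 1; set ρ^ε(x) := ε^{−d}ρ(x/ε). For g ∈ C^{1+β}_loc(ℝ^d;ℝ^d) and h ∈ C^1_loc(ℝ^d;ℝ) define R^ε(g,h) := ρ^ε ∗ (g·∇h) − g·∇(ρ^ε ∗ h). Then: (i) there exists a constant C = C(d,β,ρ), independent of ε ∈ (0,1), R > 0, g and h, such that ‖R^ε(g,h)‖_{β,R} ≤ C ‖g‖_{1+β,R+1} ‖h‖_{β,R+1}; (ii) for every fixed g ∈ C^{1+β}_loc, h ∈ C^1_loc, every R > 0 and every β' ∈ (0,β), ‖R^ε(g,h)‖_{β',R} → 0 as ε → 0. -/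
open MeasureTheory
open scoped RealInnerProductSpace

/-- The rescaled mollifier `ρ^ε(x) = ε^{-d} ρ(x/ε)`. -/
noncomputable def mollifier (d : ℕ) (ρ : EuclideanSpace ℝ (Fin d) → ℝ) (ε : ℝ) :
    EuclideanSpace ℝ (Fin d) → ℝ :=
  fun x => (ε ^ d)⁻¹ * ρ (ε⁻¹ • x)

/-- `g·∇h`. -/
noncomputable def gradDot {d : ℕ}
    (g : EuclideanSpace ℝ (Fin d) → EuclideanSpace ℝ (Fin d))
    (h : EuclideanSpace ℝ (Fin d) → ℝ) : EuclideanSpace ℝ (Fin d) → ℝ :=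
  fun x => ⟪g x, gradient h x⟫

/-- The commutator `R^ε(g,h) = ρ^ε ∗ (g·∇h) - g·∇(ρ^ε ∗ h)`. -/
noncomputable def commutatorR (d : ℕ) (ρ : EuclideanSpace ℝ (Fin d) → ℝ) (ε : ℝ)
    (g : EuclideanSpace ℝ (Fin d) → EuclideanSpace ℝ (Fin d))
    (h : EuclideanSpace ℝ (Fin d) → ℝ) : EuclideanSpace ℝ (Fin d) → ℝ :=
  fun x =>
    MeasureTheory.convolution (mollifier d ρ ε) (gradDot g h)
      (ContinuousLinearMap.lsmul ℝ ℝ) volume x -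
    gradDot g
      (MeasureTheory.convolution (mollifier d ρ ε) h
        (ContinuousLinearMap.lsmul ℝ ℝ) volume) x

/-- The `C^β` norm of a scalar function on the ball of radius `R`. -/
noncomputable def ballHolderNorm {d : ℕ} (β R : ℝ)
    (f : EuclideanSpace ℝ (Fin d) → ℝ) : ℝ :=
  sSup {r : ℝ | ∃ x : EuclideanSpace ℝ (Fin d), ‖x‖ ≤ R ∧ r = |f x|} +
  sSup {r : ℝ | ∃ x y : EuclideanSpace ℝ (Fin d),
    ‖x‖ ≤ R ∧ ‖y‖ ≤ R ∧ x ≠ y ∧ r = |f x - f y| / ‖x - y‖ ^ β}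

/-- The divergence of a vector field on Euclidean space. -/
noncomputable def euclideanDiv {d : ℕ}
    (g : EuclideanSpace ℝ (Fin d) → EuclideanSpace ℝ (Fin d)) (x : EuclideanSpace ℝ (Fin d)) : ℝ :=
  ∑ i, fderiv ℝ g x (EuclideanSpace.single i 1) i

lemma continuous_euclideanDiv {d : ℕ}
    {g : EuclideanSpace ℝ (Fin d) → EuclideanSpace ℝ (Fin d)} (hg : ContDiff ℝ 1 g) :
    Continuous (euclideanDiv g) := by
  have := hg.continuous_fderiv one_ne_zero
  unfold euclideanDiv
  fun_prop

lemma abs_sum_single_apply_le {d : ℕ}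
    (A : EuclideanSpace ℝ (Fin d) →L[ℝ] EuclideanSpace ℝ (Fin d)) :
    |∑ i, A (EuclideanSpace.single i 1) i| ≤ d * ‖A‖ := by
  refine (Finset.abs_sum_le_sum_abs _ _).trans ?_
  have : ∀ i ∈ (Finset.univ : Finset (Fin d)), |A (EuclideanSpace.single i 1) i| ≤ ‖A‖ := by
    intro i _
    rw [← Real.norm_eq_abs]
    refine (PiLp.norm_apply_le _ i).trans ((A.le_opNorm _).trans ?_)
    simp
  simpa using Finset.sum_le_card_nsmul _ _ _ this

lemma abs_euclideanDiv_le {d : ℕ}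
    (g : EuclideanSpace ℝ (Fin d) → EuclideanSpace ℝ (Fin d)) (x : EuclideanSpace ℝ (Fin d)) :
    |euclideanDiv g x| ≤ d * ‖fderiv ℝ g x‖ :=
  abs_sum_single_apply_le _

lemma abs_euclideanDiv_sub_le {d : ℕ}
    (g : EuclideanSpace ℝ (Fin d) → EuclideanSpace ℝ (Fin d)) (x y : EuclideanSpace ℝ (Fin d)) :
    |euclideanDiv g x - euclideanDiv g y| ≤ d * ‖fderiv ℝ g x - fderiv ℝ g y‖ := by
  simpa [euclideanDiv, Finset.sum_sub_distrib] using
    abs_sum_single_apply_le (fderiv ℝ g x - fderiv ℝ g y)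

/-- Integration by parts against a vector field. -/
lemma integral_mul_fderiv_vectorField {d : ℕ} {φ k : EuclideanSpace ℝ (Fin d) → ℝ}
    {V : EuclideanSpace ℝ (Fin d) → EuclideanSpace ℝ (Fin d)}
    (hφ : ContDiff ℝ 1 φ) (hφc : HasCompactSupport φ) (hk : ContDiff ℝ 1 k)
    (hV : ContDiff ℝ 1 V) :
    ∫ z, φ z * fderiv ℝ k z (V z) =
      -∫ z, k z * (fderiv ℝ φ z (V z) + φ z * euclideanDiv V z) := by
  have hφ' := hφ.continuous_fderiv one_ne_zero
  have hk' := hk.continuous_fderiv one_ne_zero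
  have hV' := hV.continuous_fderiv one_ne_zero
  have hφd := hφ.differentiable one_ne_zero
  have hkd := hk.differentiable one_ne_zero
  have hVd := hV.differentiable one_ne_zero
  have hφcont := hφ.continuous
  have hkcont := hk.continuous
  have hVcont := hV.continuous
  have hVi : ∀ i, ContDiff ℝ 1 (fun z => V z i) := fun i => by fun_prop
  have expand : ∀ (L : EuclideanSpace ℝ (Fin d) →L[ℝ] ℝ) (v : EuclideanSpace ℝ (Fin d)),
      L v = ∑ i, v i * L (EuclideanSpace.single i 1) := by
    intro L v
    conv_lhs => rw [← (EuclideanSpace.basisFun (Fin d) ℝ).sum_repr v]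
    simp [map_sum]
  have hVderiv : ∀ i z w, fderiv ℝ (fun z => V z i) z w = fderiv ℝ V z w i := by
    intro i z w
    have h1 : HasFDerivAt (fun z => V z i)
      ((EuclideanSpace.proj i : EuclideanSpace ℝ (Fin d) →L[ℝ] ℝ).comp (fderiv ℝ V z)) z :=
      (EuclideanSpace.proj i : EuclideanSpace ℝ (Fin d) →L[ℝ] ℝ).hasFDerivAt.comp z
        (hVd z).hasFDerivAt
    rw [h1.fderiv]; rfl
  have hFd : ∀ i z w, fderiv ℝ (fun z => φ z * V z i) z w =
      φ z * fderiv ℝ V z w i + V z i * fderiv ℝ φ z w := by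
    intro i z w
    rw [fderiv_fun_mul (hφd z) ((hVi i).differentiable one_ne_zero z)]
    simp [hVderiv]
  have ibp : ∀ i, ∫ z, (φ z * V z i) * fderiv ℝ k z (EuclideanSpace.single i 1) =
      -∫ z, (φ z * fderiv ℝ V z (EuclideanSpace.single i 1) i
        + V z i * fderiv ℝ φ z (EuclideanSpace.single i 1)) * k z := by
    intro i
    have hF : ContDiff ℝ 1 (fun z => φ z * V z i) := hφ.mul (hVi i)
    have hFc : HasCompactSupport (fun z => φ z * V z i) := hφc.mul_right
    have hF' := hF.continuous_fderiv one_ne_zero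
    have hFcont := hF.continuous
    have := integral_mul_fderiv_eq_neg_fderiv_mul_of_integrable (𝕜 := ℝ)
      (μ := (volume : Measure (EuclideanSpace ℝ (Fin d))))
      (f := fun z => φ z * V z i) (g := k) (v := EuclideanSpace.single i 1)
      (Continuous.integrable_of_hasCompactSupport (by fun_prop)
        ((hFc.fderiv_apply ℝ _).mul_right))
      (Continuous.integrable_of_hasCompactSupport (by fun_prop) hFc.mul_right)
      (Continuous.integrable_of_hasCompactSupport (by fun_prop) hFc.mul_right)
      (fun z _ => hF.differentiable one_ne_zero z) (fun z _ => hkd z)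
    simpa only [hFd] using this
  have hint1 : ∀ i ∈ Finset.univ, Integrable
      (fun z => (φ z * V z i) * fderiv ℝ k z (EuclideanSpace.single i 1)) := fun i _ =>
    Continuous.integrable_of_hasCompactSupport (by fun_prop) hφc.mul_right.mul_right
  have hint2 : ∀ i ∈ Finset.univ, Integrable
      (fun z => (φ z * fderiv ℝ V z (EuclideanSpace.single i 1) i
        + V z i * fderiv ℝ φ z (EuclideanSpace.single i 1)) * k z) := fun i _ =>
    Continuous.integrable_of_hasCompactSupport (by fun_prop)
      ((hφc.mul_right.add (hφc.fderiv_apply ℝ _).mul_left).mul_right)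
  calc ∫ z, φ z * fderiv ℝ k z (V z)
      = ∫ z, ∑ i, (φ z * V z i) * fderiv ℝ k z (EuclideanSpace.single i 1) := by
        congr 1; ext z
        rw [expand, Finset.mul_sum]
        simp [mul_assoc]
    _ = -∫ z, ∑ i, (φ z * fderiv ℝ V z (EuclideanSpace.single i 1) i
        + V z i * fderiv ℝ φ z (EuclideanSpace.single i 1)) * k z := by
        rw [integral_finsetSum _ hint1, integral_finsetSum _ hint2,
          Finset.sum_congr rfl (fun i _ => ibp i), Finset.sum_neg_distrib]
    _ = _ := by
        congr 2; ext z
        rw [expand (fderiv ℝ φ z), euclideanDiv, ← Finset.sum_mul, Finset.sum_add_distrib,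
          Finset.mul_sum]
        ring

/-- Convolution against a rescaled kernel, after the change of variables `t = ε z`. -/
lemma integral_rescaled_smul {d : ℕ} {F : Type*} [NormedAddCommGroup F] [NormedSpace ℝ F]
    {ε : ℝ} (hε : 0 < ε) (u : EuclideanSpace ℝ (Fin d) → EuclideanSpace ℝ (Fin d) → F)
    (x : EuclideanSpace ℝ (Fin d)) :
    ∫ t, (ε ^ d)⁻¹ • u (ε⁻¹ • t) (x - t) = ∫ z, u z (x - ε • z) := by
  have h := Measure.integral_comp_inv_smul (volume : Measure (EuclideanSpace ℝ (Fin d)))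
    (fun z => (ε ^ d)⁻¹ • u z (x - ε • z)) ε
  simp only [smul_smul, mul_inv_cancel₀ hε.ne', one_smul, finrank_euclideanSpace,
    Fintype.card_fin] at h
  rw [h, integral_smul, smul_smul, abs_of_pos (pow_pos hε d),
    mul_inv_cancel₀ (pow_pos hε d).ne', one_smul]

/-- The kernel representing the commutator as an integral operator acting on `h`. -/
noncomputable def commutatorKernel {d : ℕ} (ρ : EuclideanSpace ℝ (Fin d) → ℝ) (ε : ℝ)
    (g : EuclideanSpace ℝ (Fin d) → EuclideanSpace ℝ (Fin d))
    (x z : EuclideanSpace ℝ (Fin d)) : ℝ :=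
  fderiv ℝ ρ z (ε⁻¹ • (g (x - ε • z) - g x)) - ρ z * euclideanDiv g (x - ε • z)

lemma fderiv_comp_sub_smul {d : ℕ} {F : Type*} [NormedAddCommGroup F] [NormedSpace ℝ F]
    {u : EuclideanSpace ℝ (Fin d) → F} (hu : Differentiable ℝ u) (ε : ℝ)
    (x z w : EuclideanSpace ℝ (Fin d)) :
    fderiv ℝ (fun z => u (x - ε • z)) z w = -(ε • fderiv ℝ u (x - ε • z) w) := by
  have h1 : HasFDerivAt (fun z : EuclideanSpace ℝ (Fin d) => x - ε • z)
      (-(ε • ContinuousLinearMap.id ℝ (EuclideanSpace ℝ (Fin d)))) z :=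
    ((hasFDerivAt_id z).const_smul ε).const_sub x
  have h2 := (hu (x - ε • z)).hasFDerivAt.comp z h1
  have h3 : fderiv ℝ (fun z => u (x - ε • z)) z = _ := h2.fderiv
  rw [h3]; simp

lemma commutatorR_eq_integral {d : ℕ} {ρ : EuclideanSpace ℝ (Fin d) → ℝ} (hρ : ContDiff ℝ 1 ρ)
    (hρc : HasCompactSupport ρ) {ε : ℝ} (hε : 0 < ε)
    {g : EuclideanSpace ℝ (Fin d) → EuclideanSpace ℝ (Fin d)} (hg : ContDiff ℝ 1 g)
    {h : EuclideanSpace ℝ (Fin d) → ℝ} (hh : ContDiff ℝ 1 h) (x : EuclideanSpace ℝ (Fin d)) :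
    commutatorR d ρ ε g h x = ∫ z, h (x - ε • z) * commutatorKernel ρ ε g x z := by
  have hρ' := hρ.continuous_fderiv one_ne_zero
  have hh' := hh.continuous_fderiv one_ne_zero
  have hdiv := continuous_euclideanDiv hg
  have hρd := hρ.differentiable one_ne_zero
  have hρcont := hρ.continuous
  have hgcont := hg.continuous
  have hhcont := hh.continuous
  have hmol : ContDiff ℝ 1 (mollifier d ρ ε) := by unfold mollifier; fun_prop
  have hmolc : HasCompactSupport (mollifier d ρ ε) :=
    (hρc.comp_smul (inv_ne_zero hε.ne')).mul_left
  have hmold : ∀ t w, fderiv ℝ (mollifier d ρ ε) t w =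
      (ε ^ d)⁻¹ * (ε⁻¹ * fderiv ℝ ρ (ε⁻¹ • t) w) := by
    intro t w
    have h1 : HasFDerivAt (fun z : EuclideanSpace ℝ (Fin d) => ε⁻¹ • z)
      (ε⁻¹ • ContinuousLinearMap.id ℝ (EuclideanSpace ℝ (Fin d))) t :=
      (hasFDerivAt_id t).const_smul ε⁻¹
    have h2 := ((hρd (ε⁻¹ • t)).hasFDerivAt.comp t h1).const_mul (ε ^ d)⁻¹
    have h3 : fderiv ℝ (mollifier d ρ ε) t = _ := h2.fderiv
    rw [h3]; simp
  have first : MeasureTheory.convolution (mollifier d ρ ε) (gradDot g h)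
      (ContinuousLinearMap.lsmul ℝ ℝ) volume x =
      ∫ z, h (x - ε • z) * (ε⁻¹ * fderiv ℝ ρ z (g (x - ε • z)) -
        ρ z * euclideanDiv g (x - ε • z)) := by
    have e1 := integral_rescaled_smul hε (fun z y => ρ z * fderiv ℝ h y (g y)) x
    have e2 := integral_mul_fderiv_vectorField (φ := ρ) (k := fun z => h (x - ε • z))
      (V := fun z => g (x - ε • z)) hρ hρc (by fun_prop) (by fun_prop)
    have e3 : ∀ z, euclideanDiv (fun z => g (x - ε • z)) z =
        -(ε * euclideanDiv g (x - ε • z)) := by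
      intro z
      simp [euclideanDiv, fderiv_comp_sub_smul (hg.differentiable one_ne_zero), Finset.mul_sum]
    simp only [fderiv_comp_sub_smul (hh.differentiable one_ne_zero), e3] at e2
    have e4 : ∫ z, ρ z * fderiv ℝ h (x - ε • z) (g (x - ε • z)) =
        -ε⁻¹ * ∫ z, ρ z * -(ε • fderiv ℝ h (x - ε • z) (g (x - ε • z))) := by
      rw [← integral_const_mul]
      congr 1; ext z
      simp only [smul_eq_mul]
      field_simp
    simp only [MeasureTheory.convolution, ContinuousLinearMap.lsmul_apply, smul_eq_mul, mollifier,
      gradDot, inner_gradient_right, conj_trivial]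
    simp only [smul_eq_mul] at e1
    simp only [mul_assoc]
    rw [e1, e4, e2, neg_mul_neg, ← integral_const_mul]
    congr 1; ext z
    field_simp
    ring
  have second : gradDot g (MeasureTheory.convolution (mollifier d ρ ε) h
        (ContinuousLinearMap.lsmul ℝ ℝ) volume) x =
      ∫ z, h (x - ε • z) * (ε⁻¹ * fderiv ℝ ρ z (g x)) := by
    have e1 := integral_rescaled_smul hε
      (fun z y => h y * (ε⁻¹ * fderiv ℝ ρ z (g x))) x
    have e2 := hmolc.hasFDerivAt_convolution_left (ContinuousLinearMap.lsmul ℝ ℝ) hmol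
      (hhcont.locallyIntegrable (μ := volume)) x
    have e3 : ConvolutionExistsAt (fderiv ℝ (mollifier d ρ ε)) h x
        ((ContinuousLinearMap.lsmul ℝ ℝ).precompL (EuclideanSpace ℝ (Fin d))) volume :=
      (hmolc.fderiv ℝ).convolutionExists_left _ (hmol.continuous_fderiv one_ne_zero)
        (hhcont.locallyIntegrable (μ := volume)) x
    simp only [gradDot, inner_gradient_right, conj_trivial]
    rw [e2.fderiv, ← e1, MeasureTheory.convolution, ContinuousLinearMap.integral_apply e3]
    congr 1; ext t
    simp [ContinuousLinearMap.precompL_apply, hmold]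
    ring
  rw [commutatorR, first, second, ← integral_sub]
  · congr 1; ext z
    simp [commutatorKernel, smul_sub]
    ring
  · refine Continuous.integrable_of_hasCompactSupport (by fun_prop) (HasCompactSupport.mul_left ?_)
    refine HasCompactSupport.sub (HasCompactSupport.mul_left ?_) hρc.mul_right
    exact (hρc.fderiv ℝ).mono' fun z hz => subset_closure fun h0 => hz (by simp [h0])
  · refine Continuous.integrable_of_hasCompactSupport (by fun_prop) (HasCompactSupport.mul_left ?_)
    exact (hρc.fderiv_apply ℝ _).mul_left

lemma eq_zero_of_one_lt_norm {d : ℕ} {ρ : EuclideanSpace ℝ (Fin d) → ℝ}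
    (hρsupp : Function.support ρ ⊆ Metric.ball 0 1) {z : EuclideanSpace ℝ (Fin d)}
    (hz : 1 < ‖z‖) : ρ z = 0 ∧ fderiv ℝ ρ z = 0 := by
  have hcl : tsupport ρ ⊆ Metric.closedBall 0 1 :=
    closure_minimal (hρsupp.trans Metric.ball_subset_closedBall) Metric.isClosed_closedBall
  have hz' : z ∉ tsupport ρ := fun h => by
    have := hcl h
    rw [mem_closedBall_zero_iff] at this
    linarith
  exact ⟨image_eq_zero_of_notMem_tsupport hz',
    Function.notMem_support.1 fun h => hz' (support_fderiv_subset ℝ h)⟩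

lemma hasCompactSupport_of_support_subset_ball {d : ℕ} {ρ : EuclideanSpace ℝ (Fin d) → ℝ}
    (hρsupp : Function.support ρ ⊆ Metric.ball 0 1) : HasCompactSupport ρ :=
  HasCompactSupport.of_support_subset_isCompact (isCompact_closedBall 0 1)
    (hρsupp.trans Metric.ball_subset_closedBall)

/-- The integrable weight dominating the commutator kernel. -/
noncomputable def kernelWeight {d : ℕ} (ρ : EuclideanSpace ℝ (Fin d) → ℝ)
    (z : EuclideanSpace ℝ (Fin d)) : ℝ :=
  ‖fderiv ℝ ρ z‖ + d * ρ z

lemma kernelWeight_nonneg {d : ℕ} {ρ : EuclideanSpace ℝ (Fin d) → ℝ} (hρpos : ∀ x, 0 ≤ ρ x)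
    (z : EuclideanSpace ℝ (Fin d)) : 0 ≤ kernelWeight ρ z := by
  have := hρpos z
  unfold kernelWeight
  positivity

lemma integrable_kernelWeight {d : ℕ} {ρ : EuclideanSpace ℝ (Fin d) → ℝ}
    (hρ : ContDiff ℝ 1 ρ) (hρc : HasCompactSupport ρ) : Integrable (kernelWeight ρ) := by
  have hρ' := hρ.continuous_fderiv one_ne_zero
  have hρcont := hρ.continuous
  unfold kernelWeight
  exact Continuous.integrable_of_hasCompactSupport (by fun_prop)
    ((hρc.fderiv ℝ).norm.add hρc.mul_left)

lemma norm_sub_smul_le {d : ℕ} {ε R : ℝ} (hε0 : 0 < ε) (hε1 : ε < 1)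
    {x z : EuclideanSpace ℝ (Fin d)} (hx : ‖x‖ ≤ R) (hz : ‖z‖ ≤ 1) :
    ‖x - ε • z‖ ≤ R + 1 := by
  refine (norm_sub_le _ _).trans (add_le_add hx ?_)
  rw [norm_smul, Real.norm_of_nonneg hε0.le]
  nlinarith [norm_nonneg z]

/-- A kernel of the same shape as the commutator kernel is dominated by the weight. -/
lemma abs_apply_sub_mul_le {d : ℕ} {ρ : EuclideanSpace ℝ (Fin d) → ℝ} (hρpos : ∀ x, 0 ≤ ρ x)
    {z w : EuclideanSpace ℝ (Fin d)} {s B : ℝ} (hw : ‖w‖ ≤ B) (hs : |s| ≤ d * B) :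
    |fderiv ℝ ρ z w - ρ z * s| ≤ B * kernelWeight ρ z := by
  have h1 : |fderiv ℝ ρ z w| ≤ ‖fderiv ℝ ρ z‖ * B :=
    ((fderiv ℝ ρ z).le_opNorm w).trans (by gcongr)
  have h2 : |ρ z * s| ≤ ρ z * (d * B) := by
    rw [abs_mul, abs_of_nonneg (hρpos z)]
    exact mul_le_mul_of_nonneg_left hs (hρpos z)
  calc _ ≤ |fderiv ℝ ρ z w| + |ρ z * s| := abs_sub _ _
    _ ≤ _ := by unfold kernelWeight; linarith

lemma abs_commutatorKernel_le {d : ℕ} {ρ : EuclideanSpace ℝ (Fin d) → ℝ}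
    (hρpos : ∀ x, 0 ≤ ρ x) {ε R G : ℝ} (hε0 : 0 < ε) (hε1 : ε < 1)
    {g : EuclideanSpace ℝ (Fin d) → EuclideanSpace ℝ (Fin d)} (hg : Differentiable ℝ g)
    (hG : ∀ x, ‖x‖ ≤ R + 1 → ‖fderiv ℝ g x‖ ≤ G)
    {x z : EuclideanSpace ℝ (Fin d)} (hx : ‖x‖ ≤ R) (hz : ‖z‖ ≤ 1) :
    |commutatorKernel ρ ε g x z| ≤ G * kernelWeight ρ z := by
  have hxz := norm_sub_smul_le hε0 hε1 hx hz
  have hG0 : 0 ≤ G := (norm_nonneg _).trans (hG _ hxz)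
  refine abs_apply_sub_mul_le hρpos ?_ ((abs_euclideanDiv_le g _).trans ?_)
  · have := (convex_closedBall (0 : EuclideanSpace ℝ (Fin d))
      (R + 1)).norm_image_sub_le_of_norm_fderiv_le
      (𝕜 := ℝ) (f := g) (C := G) (x := x) (y := x - ε • z) (fun y _ => hg y)
      (fun y hy => hG y (mem_closedBall_zero_iff.1 hy))
      (mem_closedBall_zero_iff.2 (by linarith)) (mem_closedBall_zero_iff.2 hxz)
    rw [sub_sub_cancel_left, norm_neg, norm_smul, Real.norm_of_nonneg hε0.le] at this
    rw [norm_smul, norm_inv, Real.norm_of_nonneg hε0.le, inv_mul_le_iff₀ hε0]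
    refine this.trans ?_
    nlinarith [mul_nonneg hG0 hε0.le]
  · gcongr
    exact hG _ hxz

lemma abs_commutatorKernel_sub_le {d : ℕ} {ρ : EuclideanSpace ℝ (Fin d) → ℝ}
    (hρpos : ∀ x, 0 ≤ ρ x) {ε B : ℝ} (hε0 : 0 < ε) (hε1 : ε < 1)
    {g : EuclideanSpace ℝ (Fin d) → EuclideanSpace ℝ (Fin d)} (hg : Differentiable ℝ g)
    {x y z : EuclideanSpace ℝ (Fin d)}
    (hB : ∀ u, ‖u‖ ≤ 1 → ‖fderiv ℝ g (x + u) - fderiv ℝ g (y + u)‖ ≤ B) (hz : ‖z‖ ≤ 1) :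
    |commutatorKernel ρ ε g x z - commutatorKernel ρ ε g y z| ≤ B * kernelWeight ρ z := by
  have hεz : ‖-(ε • z)‖ ≤ 1 := by
    rw [norm_neg, norm_smul, Real.norm_of_nonneg hε0.le]
    nlinarith [norm_nonneg z]
  have hB0 : 0 ≤ B := (norm_nonneg _).trans (hB _ hεz)
  have e : commutatorKernel ρ ε g x z - commutatorKernel ρ ε g y z =
      fderiv ℝ ρ z (ε⁻¹ • ((g (x - ε • z) - g (y - ε • z)) - (g x - g y))) -
        ρ z * (euclideanDiv g (x - ε • z) - euclideanDiv g (y - ε • z)) := by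
    simp only [commutatorKernel, map_smul, map_sub, smul_eq_mul]
    ring
  rw [e]
  refine abs_apply_sub_mul_le hρpos ?_ ((abs_euclideanDiv_sub_le g _ _).trans ?_)
  · have := (convex_closedBall (0 : EuclideanSpace ℝ (Fin d))
      1).norm_image_sub_le_of_norm_hasFDerivWithin_le
      (𝕜 := ℝ) (f := fun u => g (x + u) - g (y + u)) (C := B) (x := 0) (y := -(ε • z))
      (f' := fun u => fderiv ℝ g (x + u) - fderiv ℝ g (y + u))
      (fun u _ => (((hasFDerivAt_comp_add_left x).2 (hg _).hasFDerivAt).sub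
        ((hasFDerivAt_comp_add_left y).2 (hg _).hasFDerivAt)).hasFDerivWithinAt)
      (fun u hu => hB u (mem_closedBall_zero_iff.1 hu))
      (by simp) (mem_closedBall_zero_iff.2 hεz)
    simp only [add_zero, sub_zero, ← sub_eq_add_neg, norm_neg] at this
    rw [norm_smul ε, Real.norm_of_nonneg hε0.le] at this
    rw [norm_smul, norm_inv, Real.norm_of_nonneg hε0.le, inv_mul_le_iff₀ hε0]
    refine this.trans ?_
    nlinarith [mul_nonneg hB0 hε0.le]
  · gcongr
    simpa only [← sub_eq_add_neg] using hB _ hεz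

lemma commutatorKernel_eq_zero {d : ℕ} {ρ : EuclideanSpace ℝ (Fin d) → ℝ}
    (hρsupp : Function.support ρ ⊆ Metric.ball 0 1) (ε : ℝ)
    (g : EuclideanSpace ℝ (Fin d) → EuclideanSpace ℝ (Fin d))
    (x : EuclideanSpace ℝ (Fin d)) {z : EuclideanSpace ℝ (Fin d)} (hz : 1 < ‖z‖) :
    commutatorKernel ρ ε g x z = 0 := by
  simp [commutatorKernel, eq_zero_of_one_lt_norm hρsupp hz]

lemma integrable_mul_commutatorKernel {d : ℕ} {ρ : EuclideanSpace ℝ (Fin d) → ℝ}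
    (hρ : ContDiff ℝ 1 ρ) (hρsupp : Function.support ρ ⊆ Metric.ball 0 1) (ε : ℝ)
    {g : EuclideanSpace ℝ (Fin d) → EuclideanSpace ℝ (Fin d)} (hg : ContDiff ℝ 1 g)
    {a : EuclideanSpace ℝ (Fin d) → ℝ} (ha : Continuous a) (x : EuclideanSpace ℝ (Fin d)) :
    Integrable fun z => a z * commutatorKernel ρ ε g x z := by
  have hρ' := hρ.continuous_fderiv one_ne_zero
  have hdiv := continuous_euclideanDiv hg
  have hρcont := hρ.continuous
  have hgcont := hg.continuous
  have hK : Continuous fun z => commutatorKernel ρ ε g x z := by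
    unfold commutatorKernel; fun_prop
  refine Continuous.integrable_of_hasCompactSupport (ha.mul hK) (HasCompactSupport.mul_left ?_)
  refine HasCompactSupport.of_support_subset_isCompact (isCompact_closedBall 0 1) fun z hz => ?_
  by_contra hz'
  rw [mem_closedBall_zero_iff, not_le] at hz'
  exact hz (commutatorKernel_eq_zero hρsupp ε g x hz')

/-- An integrand that vanishes off the unit ball and is dominated there by a multiple of the
weight has controlled integral. -/
lemma abs_integral_le_mul_integral_kernelWeight {d : ℕ} {ρ : EuclideanSpace ℝ (Fin d) → ℝ}
    (hρ : ContDiff ℝ 1 ρ) (hρsupp : Function.support ρ ⊆ Metric.ball 0 1)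
    {f : EuclideanSpace ℝ (Fin d) → ℝ} {B : ℝ}
    (hf0 : ∀ z, 1 < ‖z‖ → f z = 0) (hf : ∀ z, ‖z‖ ≤ 1 → |f z| ≤ B * kernelWeight ρ z) :
    |∫ z, f z| ≤ B * ∫ z, kernelWeight ρ z := by
  rw [← integral_const_mul, ← Real.norm_eq_abs]
  refine norm_integral_le_of_norm_le ((integrable_kernelWeight hρ
    (hasCompactSupport_of_support_subset_ball hρsupp)).const_mul B) (Filter.Eventually.of_forall
    fun z => ?_)
  rcases le_or_gt ‖z‖ 1 with hz | hz
  · exact hf z hz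
  · simp [hf0 z hz, kernelWeight, eq_zero_of_one_lt_norm hρsupp hz]

lemma abs_commutatorR_le {d : ℕ} {ρ : EuclideanSpace ℝ (Fin d) → ℝ} (hρ : ContDiff ℝ 1 ρ)
    (hρpos : ∀ x, 0 ≤ ρ x) (hρsupp : Function.support ρ ⊆ Metric.ball 0 1)
    {ε R G H : ℝ} (hε0 : 0 < ε) (hε1 : ε < 1)
    {g : EuclideanSpace ℝ (Fin d) → EuclideanSpace ℝ (Fin d)} (hg : ContDiff ℝ 1 g)
    {h : EuclideanSpace ℝ (Fin d) → ℝ} (hh : ContDiff ℝ 1 h)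
    (hG : ∀ x, ‖x‖ ≤ R + 1 → ‖fderiv ℝ g x‖ ≤ G)
    {x : EuclideanSpace ℝ (Fin d)} (hx : ‖x‖ ≤ R) (c : ℝ)
    (hH : ∀ z, ‖z‖ ≤ 1 → |h (x - ε • z) - c| ≤ H) :
    |commutatorR d ρ ε g h x| ≤ H * G * ∫ z, kernelWeight ρ z := by
  have hρc := hasCompactSupport_of_support_subset_ball hρsupp
  have hone : ∫ z, c * commutatorKernel ρ ε g x z = 0 := by
    rw [← commutatorR_eq_integral hρ hρc hε0 hg (h := fun _ => c) contDiff_const]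
    have hconv : MeasureTheory.convolution (mollifier d ρ ε) (fun _ => c)
        (ContinuousLinearMap.lsmul ℝ ℝ) volume = fun _ => ∫ t, mollifier d ρ ε t * c := by
      ext y; simp [MeasureTheory.convolution]
    have hgrad : ∀ c : ℝ, gradDot g (fun _ => c) = fun _ => 0 := by
      intro c; ext y; simp [gradDot]
    rw [commutatorR, hconv, hgrad, hgrad]
    simp [MeasureTheory.convolution]
  have hhcont := hh.continuous
  have e : commutatorR d ρ ε g h x =
      ∫ z, (h (x - ε • z) - c) * commutatorKernel ρ ε g x z := by
    rw [commutatorR_eq_integral hρ hρc hε0 hg hh, ← sub_zero (∫ z, h _ * _), ← hone,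
      ← integral_sub]
    · simp only [sub_mul]
    · exact integrable_mul_commutatorKernel hρ hρsupp ε hg (by fun_prop) x
    · exact integrable_mul_commutatorKernel hρ hρsupp ε hg (by fun_prop) x
  rw [e]
  refine abs_integral_le_mul_integral_kernelWeight hρ hρsupp
    (fun z hz => by simp [commutatorKernel_eq_zero hρsupp ε g x hz]) fun z hz => ?_
  rw [abs_mul, mul_assoc]
  exact mul_le_mul (hH z hz) (abs_commutatorKernel_le hρpos hε0 hε1
    (hg.differentiable one_ne_zero) hG hx hz) (abs_nonneg _) ((abs_nonneg _).trans (hH z hz))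

lemma abs_commutatorR_sub_le {d : ℕ} {ρ : EuclideanSpace ℝ (Fin d) → ℝ} (hρ : ContDiff ℝ 1 ρ)
    (hρpos : ∀ x, 0 ≤ ρ x) (hρsupp : Function.support ρ ⊆ Metric.ball 0 1)
    {β ε R G H : ℝ} (hε0 : 0 < ε) (hε1 : ε < 1)
    {g : EuclideanSpace ℝ (Fin d) → EuclideanSpace ℝ (Fin d)} (hg : ContDiff ℝ 1 g)
    {h : EuclideanSpace ℝ (Fin d) → ℝ} (hh : ContDiff ℝ 1 h)
    (hG : ∀ x, ‖x‖ ≤ R + 1 → ‖fderiv ℝ g x‖ ≤ G)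
    (hGβ : ∀ x y, ‖x‖ ≤ R + 1 → ‖y‖ ≤ R + 1 →
      ‖fderiv ℝ g x - fderiv ℝ g y‖ ≤ G * ‖x - y‖ ^ β)
    (hH : ∀ x, ‖x‖ ≤ R + 1 → |h x| ≤ H)
    (hHβ : ∀ x y, ‖x‖ ≤ R + 1 → ‖y‖ ≤ R + 1 → |h x - h y| ≤ H * ‖x - y‖ ^ β)
    {x y : EuclideanSpace ℝ (Fin d)} (hx : ‖x‖ ≤ R) (hy : ‖y‖ ≤ R) :
    |commutatorR d ρ ε g h x - commutatorR d ρ ε g h y| ≤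
      (2 * ∫ z, kernelWeight ρ z) * G * H * ‖x - y‖ ^ β := by
  have hρc := hasCompactSupport_of_support_subset_ball hρsupp
  have hhcont := hh.continuous
  have hgd := hg.differentiable one_ne_zero
  rw [commutatorR_eq_integral hρ hρc hε0 hg hh, commutatorR_eq_integral hρ hρc hε0 hg hh,
    ← integral_sub (integrable_mul_commutatorKernel hρ hρsupp ε hg (by fun_prop) x)
      (integrable_mul_commutatorKernel hρ hρsupp ε hg (by fun_prop) y)]
  have key := abs_integral_le_mul_integral_kernelWeight hρ hρsupp
    (f := fun z => h (x - ε • z) * commutatorKernel ρ ε g x z -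
      h (y - ε • z) * commutatorKernel ρ ε g y z) (B := 2 * G * H * ‖x - y‖ ^ β)
    (fun z hz => by simp [commutatorKernel_eq_zero hρsupp ε g _ hz]) fun z hz => ?_
  · refine key.trans (le_of_eq (by ring))
  have hxz := norm_sub_smul_le hε0 hε1 hx hz
  have hyz := norm_sub_smul_le hε0 hε1 hy hz
  have h1 := abs_commutatorKernel_le hρpos hε0 hε1 hgd hG hx hz
  have h2 := abs_commutatorKernel_sub_le hρpos hε0 hε1 hgd (x := x) (y := y)
    (B := G * ‖x - y‖ ^ β) (fun u hu => by
      simpa using hGβ (x + u) (y + u) ((norm_add_le _ _).trans (add_le_add hx hu))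
        ((norm_add_le _ _).trans (add_le_add hy hu))) hz
  have h3 := hHβ _ _ hxz hyz
  rw [sub_sub_sub_cancel_right] at h3
  have h4 := hH _ hyz
  have e : h (x - ε • z) * commutatorKernel ρ ε g x z -
      h (y - ε • z) * commutatorKernel ρ ε g y z =
      (h (x - ε • z) - h (y - ε • z)) * commutatorKernel ρ ε g x z +
      h (y - ε • z) * (commutatorKernel ρ ε g x z - commutatorKernel ρ ε g y z) := by ring
  simp only [e]
  refine (abs_add_le _ _).trans ?_
  rw [abs_mul, abs_mul]
  have h5 := mul_le_mul h3 h1 (abs_nonneg _) ((abs_nonneg _).trans h3)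
  have h6 := mul_le_mul h4 h2 (abs_nonneg _) ((abs_nonneg _).trans h4)
  linarith

/-- Interpolation between a sup bound and a Hölder bound. -/
lemma div_rpow_le_of_le_of_le {a r K S β β' : ℝ} (ha : 0 ≤ a) (hr : 0 < r) (hK : 0 ≤ K)
    (hβ' : 0 < β') (hβ : β' < β) (h1 : a ≤ K * r ^ β) (h2 : a ≤ S) :
    a / r ^ β' ≤ K ^ (β' / β) * S ^ (1 - β' / β) := by
  have hβ0 : 0 < β := hβ'.trans hβ
  have hθ0 : 0 ≤ β' / β := by positivity
  have hθ1 : 0 ≤ 1 - β' / β := sub_nonneg.2 ((div_le_one hβ0).2 hβ.le)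
  rw [div_le_iff₀ (by positivity)]
  calc a = a ^ (β' / β) * a ^ (1 - β' / β) := by
        rw [← Real.rpow_add_of_nonneg ha hθ0 hθ1, add_sub_cancel, Real.rpow_one]
    _ ≤ (K * r ^ β) ^ (β' / β) * S ^ (1 - β' / β) := by gcongr
    _ = K ^ (β' / β) * S ^ (1 - β' / β) * r ^ β' := by
        rw [Real.mul_rpow hK (by positivity), ← Real.rpow_mul hr.le, mul_div_cancel₀ _ hβ0.ne']
        ring

lemma ballHolderNorm_nonneg {d : ℕ} (β R : ℝ) (f : EuclideanSpace ℝ (Fin d) → ℝ) :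
    0 ≤ ballHolderNorm β R f := by
  refine add_nonneg (Real.sSup_nonneg ?_) (Real.sSup_nonneg ?_)
  · rintro r ⟨x, _, rfl⟩
    positivity
  · rintro r ⟨x, y, _, _, _, rfl⟩
    positivity

lemma ballHolderNorm_le_of_interpolation {d : ℕ} {β β' R S K : ℝ}
    {f : EuclideanSpace ℝ (Fin d) → ℝ} (hβ' : 0 < β') (hβ : β' < β) (hS0 : 0 ≤ S) (hK0 : 0 ≤ K)
    (hS : ∀ x, ‖x‖ ≤ R → |f x| ≤ S)
    (hK : ∀ x y, ‖x‖ ≤ R → ‖y‖ ≤ R → |f x - f y| ≤ K * ‖x - y‖ ^ β) :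
    ballHolderNorm β' R f ≤ S + K ^ (β' / β) * (2 * S) ^ (1 - β' / β) := by
  refine add_le_add (Real.sSup_le ?_ hS0) (Real.sSup_le ?_ (by positivity))
  · rintro r ⟨x, hx, rfl⟩
    exact hS x hx
  · rintro r ⟨x, y, hx, hy, hxy, rfl⟩
    refine div_rpow_le_of_le_of_le (abs_nonneg _) (norm_pos_iff.2 (sub_ne_zero.2 hxy)) hK0 hβ' hβ
      (hK x y hx hy) ((abs_sub _ _).trans ?_)
    linarith [hS x hx, hS y hy]

lemma exists_bound_on_ball {d : ℕ} {F : Type*} [SeminormedAddCommGroup F]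
    {f : EuclideanSpace ℝ (Fin d) → F} (hf : Continuous f) (R : ℝ) :
    ∃ M, 0 ≤ M ∧ ∀ x, ‖x‖ ≤ R → ‖f x‖ ≤ M := by
  obtain ⟨M, hM⟩ := (isCompact_closedBall (0 : EuclideanSpace ℝ (Fin d))
    R).exists_bound_of_continuousOn hf.continuousOn
  exact ⟨max M 0, le_max_right _ _, fun x hx =>
    (hM x (mem_closedBall_zero_iff.2 hx)).trans (le_max_left _ _)⟩

/-- **Commutator lemma.**  For a mollifier `ρ` and `R^ε(g,h) = ρ^ε ∗ (g·∇h) - g·∇(ρ^ε ∗ h)`: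
(i) `‖R^ε(g,h)‖_{β,R} ≤ C ‖g‖_{1+β,R+1} ‖h‖_{β,R+1}` with `C = C(d,β,ρ)` independent of
`ε ∈ (0,1)`, `R`, `g`, `h`;  (ii) for fixed `g ∈ C^{1+β}_loc`, `h ∈ C^1_loc` and `β' < β`,
`‖R^ε(g,h)‖_{β',R} → 0` as `ε → 0`. -/
theorem commutator_lemma
    (d : ℕ) (hd : 1 ≤ d) (β : ℝ) (hβ0 : 0 < β) (hβ1 : β < 1)
    (ρ : EuclideanSpace ℝ (Fin d) → ℝ)
    (hρsmooth : ContDiff ℝ (⊤ : ℕ∞) ρ)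
    (hρpos : ∀ x, 0 ≤ ρ x)
    (hρsupp : Function.support ρ ⊆ Metric.ball 0 1)
    (hρint : ∫ x, ρ x = 1) :
    (∃ C : ℝ, 0 ≤ C ∧
      ∀ (ε R G H : ℝ)
        (g : EuclideanSpace ℝ (Fin d) → EuclideanSpace ℝ (Fin d))
        (h : EuclideanSpace ℝ (Fin d) → ℝ),
        0 < ε → ε < 1 → 0 < R →
        ContDiff ℝ 1 g → ContDiff ℝ 1 h →
        (∀ x, ‖x‖ ≤ R + 1 → ‖g x‖ ≤ G) →
        (∀ x, ‖x‖ ≤ R + 1 → ‖fderiv ℝ g x‖ ≤ G) →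
        (∀ x y, ‖x‖ ≤ R + 1 → ‖y‖ ≤ R + 1 →
          ‖fderiv ℝ g x - fderiv ℝ g y‖ ≤ G * ‖x - y‖ ^ β) →
        (∀ x, ‖x‖ ≤ R + 1 → |h x| ≤ H) →
        (∀ x y, ‖x‖ ≤ R + 1 → ‖y‖ ≤ R + 1 → |h x - h y| ≤ H * ‖x - y‖ ^ β) →
        (∀ x, ‖x‖ ≤ R → |commutatorR d ρ ε g h x| ≤ C * G * H) ∧
        (∀ x y, ‖x‖ ≤ R → ‖y‖ ≤ R →
          |commutatorR d ρ ε g h x - commutatorR d ρ ε g h y| ≤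
            C * G * H * ‖x - y‖ ^ β)) ∧
    (∀ (g : EuclideanSpace ℝ (Fin d) → EuclideanSpace ℝ (Fin d))
        (h : EuclideanSpace ℝ (Fin d) → ℝ),
      ContDiff ℝ 1 g → ContDiff ℝ 1 h →
      (∀ R : ℝ, 0 < R → ∃ CR : ℝ, ∀ x y, ‖x‖ ≤ R → ‖y‖ ≤ R →
        ‖fderiv ℝ g x - fderiv ℝ g y‖ ≤ CR * ‖x - y‖ ^ β) →
      ∀ R β' : ℝ, 0 < R → 0 < β' → β' < β →
        Filter.Tendsto (fun ε => ballHolderNorm β' R (commutatorR d ρ ε g h))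
          (nhdsWithin 0 (Set.Ioi 0)) (nhds 0)) := by
  have hρ1 : ContDiff ℝ 1 ρ := hρsmooth.of_le (by exact_mod_cast le_top)
  have hW : 0 ≤ ∫ z, kernelWeight ρ z := integral_nonneg (kernelWeight_nonneg hρpos)
  refine ⟨⟨2 * ∫ z, kernelWeight ρ z, by positivity, ?_⟩, ?_⟩
  · intro ε R G H g h hε0 hε1 hR hg hh _ hG hGβ hH hHβ
    refine ⟨fun x hx => ?_, fun x y hx hy => abs_commutatorR_sub_le hρ1 hρpos hρsupp hε0 hε1
      hg hh hG hGβ hH hHβ hx hy⟩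
    have hG0 : 0 ≤ G := (norm_nonneg _).trans (hG x (by linarith))
    have hH0 : 0 ≤ H := (abs_nonneg _).trans (hH x (by linarith))
    refine (abs_commutatorR_le hρ1 hρpos hρsupp hε0 hε1 hg hh hG hx 0 fun z hz => by
      simpa using hH _ (norm_sub_smul_le hε0 hε1 hx hz)).trans ?_
    nlinarith [mul_nonneg (mul_nonneg hH0 hG0) hW]
  · intro g h hg hh hgβ R β' hR hβ'0 hβ'
    obtain ⟨CR, hCR⟩ := hgβ (R + 1) (by linarith)
    obtain ⟨Mg, hMg0, hMg⟩ := exists_bound_on_ball (hg.continuous_fderiv one_ne_zero) (R + 1)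
    obtain ⟨Mh, hMh0, hMh⟩ := exists_bound_on_ball hh.continuous (R + 1)
    obtain ⟨L, hL0, hL⟩ := exists_bound_on_ball (hh.continuous_fderiv one_ne_zero) (R + 1)
    have hlip : ∀ x y, ‖x‖ ≤ R + 1 → ‖y‖ ≤ R + 1 → |h x - h y| ≤ L * ‖x - y‖ := by
      intro x y hx hy
      exact (convex_closedBall (0 : EuclideanSpace ℝ (Fin d))
        (R + 1)).norm_image_sub_le_of_norm_fderiv_le
        (𝕜 := ℝ) (f := h) (fun z _ => hh.differentiable one_ne_zero z)
        (fun z hz => hL z (mem_closedBall_zero_iff.1 hz))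
        (mem_closedBall_zero_iff.2 hy) (mem_closedBall_zero_iff.2 hx)
    set G := max Mg CR
    set H := max Mh (L * (2 * (R + 1)) ^ (1 - β))
    have hG0 : 0 ≤ G := hMg0.trans (le_max_left _ _)
    have hH0 : 0 ≤ H := hMh0.trans (le_max_left _ _)
    have hG : ∀ x, ‖x‖ ≤ R + 1 → ‖fderiv ℝ g x‖ ≤ G := fun x hx =>
      (hMg x hx).trans (le_max_left _ _)
    have hGβ : ∀ x y, ‖x‖ ≤ R + 1 → ‖y‖ ≤ R + 1 →
        ‖fderiv ℝ g x - fderiv ℝ g y‖ ≤ G * ‖x - y‖ ^ β := fun x y hx hy =>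
      (hCR x y hx hy).trans (by gcongr; exact le_max_right _ _)
    have hH : ∀ x, ‖x‖ ≤ R + 1 → |h x| ≤ H := fun x hx => (hMh x hx).trans (le_max_left _ _)
    have hHβ : ∀ x y, ‖x‖ ≤ R + 1 → ‖y‖ ≤ R + 1 → |h x - h y| ≤ H * ‖x - y‖ ^ β := by
      intro x y hx hy
      have hxy : ‖x - y‖ ≤ 2 * (R + 1) := (norm_sub_le _ _).trans (by linarith)
      have h1β : 0 ≤ 1 - β := by linarith
      calc |h x - h y| ≤ L * ‖x - y‖ := hlip x y hx hy
        _ = L * ‖x - y‖ ^ (1 - β) * ‖x - y‖ ^ β := by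
          rw [mul_assoc, ← Real.rpow_add_of_nonneg (norm_nonneg _) h1β hβ0.le,
            sub_add_cancel, Real.rpow_one]
        _ ≤ L * (2 * (R + 1)) ^ (1 - β) * ‖x - y‖ ^ β := by gcongr
        _ ≤ H * ‖x - y‖ ^ β := by gcongr; exact le_max_right _ _
    set I := ∫ z, kernelWeight ρ z
    have hbound : ∀ᶠ ε in nhdsWithin (0 : ℝ) (Set.Ioi 0),
        ballHolderNorm β' R (commutatorR d ρ ε g h) ≤ L * ε * G * I +
          (2 * I * G * H) ^ (β' / β) * (2 * (L * ε * G * I)) ^ (1 - β' / β) := by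
      filter_upwards [Ioo_mem_nhdsGT (zero_lt_one (α := ℝ))] with ε hε
      obtain ⟨hε0, hε1⟩ := hε
      refine ballHolderNorm_le_of_interpolation hβ'0 hβ' (by positivity) (by positivity)
        (fun x hx => ?_) (fun x y hx hy => abs_commutatorR_sub_le hρ1 hρpos hρsupp hε0 hε1
          hg hh hG hGβ hH hHβ hx hy)
      refine abs_commutatorR_le hρ1 hρpos hρsupp hε0 hε1 hg hh hG hx (h x) fun z hz => ?_
      refine (hlip _ _ (norm_sub_smul_le hε0 hε1 hx hz) (by linarith)).trans ?_
      rw [sub_sub_cancel_left, norm_neg, norm_smul, Real.norm_of_nonneg hε0.le]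
      gcongr
      nlinarith
    have hθ : 0 < 1 - β' / β := sub_pos.2 ((div_lt_one hβ0).2 hβ')
    have hcont : Continuous fun ε : ℝ => L * ε * G * I +
        (2 * I * G * H) ^ (β' / β) * (2 * (L * ε * G * I)) ^ (1 - β' / β) := by
      have : Continuous fun ε : ℝ => (2 * (L * ε * G * I)) ^ (1 - β' / β) :=
        Continuous.rpow_const (by fun_prop) fun _ => Or.inr hθ.le
      fun_prop
    have hlim := (hcont.tendsto 0).mono_left (nhdsWithin_le_nhds (s := Set.Ioi 0))
    simp only [mul_zero, zero_mul, Real.zero_rpow hθ.ne', add_zero] at hlim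
    exact squeeze_zero' (Filter.Eventually.of_forall fun ε => ballHolderNorm_nonneg _ _ _)
      hbound hlim
end

section
/- Fubini theorem for the sewing map: Let 0 < α < 1 < β, T > 0, V a separable Banach space, (S,𝒜,μ) a measure space, and Γ : S → C₂^{α,β}([0,T];V) a strongly measurable map with ∫_S ‖Γ(θ)‖_{α,β} μ(dθ) < ∞. Then: the map θ ↦ 𝒥(Γ(θ)) is strongly measurable from S to C^α([0,T];V); the family of pointwise Bochner integrals Γ̄_{s,t} := ∫_S Γ(θ)_{s,t} μ(dθ) defines an element Γ̄ ∈ C₂^{α,β}([0,T];V) with ‖Γ̄‖_{α,β} ≤ ∫_S ‖Γ(θ)‖_{α,β} μ(dθ); and 𝒥(Γ̄)_t = ∫_S 𝒥(Γ(θ))_t μ(dθ) for every t ∈ [0,T]. -/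
open MeasureTheory

/-- `Γ` satisfies the `C₂^{α,β}` bounds on `[0,T]` with constant `M`. -/
def HasGermBounds {V : Type*} [NormedAddCommGroup V]
    (α β T : ℝ) (Γ : ℝ → ℝ → V) (M : ℝ) : Prop :=
  (∀ s t : ℝ, 0 ≤ s → s ≤ t → t ≤ T → ‖Γ s t‖ ≤ M * (t - s) ^ α) ∧
  (∀ s u t : ℝ, 0 ≤ s → s ≤ u → u ≤ t → t ≤ T →
    ‖Γ s t - Γ s u - Γ u t‖ ≤ M * (t - s) ^ β)

/-- The `C₂^{α,β}` norm on `[0,T]` of a germ `Γ`. -/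
noncomputable def germNorm {V : Type*} [NormedAddCommGroup V]
    (α β T : ℝ) (Γ : ℝ → ℝ → V) : ℝ :=
  sSup {r : ℝ | ∃ s t : ℝ, 0 ≤ s ∧ s < t ∧ t ≤ T ∧ r = ‖Γ s t‖ / (t - s) ^ α} +
  sSup {r : ℝ | ∃ s u t : ℝ, 0 ≤ s ∧ s ≤ u ∧ u ≤ t ∧ t ≤ T ∧ s < t ∧
    r = ‖Γ s t - Γ s u - Γ u t‖ / (t - s) ^ β}

/-- The `C^α` norm on `[0,T]` of a path. -/
noncomputable def pathNorm {V : Type*} [NormedAddCommGroup V]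
    (α T : ℝ) (f : ℝ → V) : ℝ :=
  sSup {r : ℝ | ∃ t : ℝ, 0 ≤ t ∧ t ≤ T ∧ r = ‖f t‖} +
  sSup {r : ℝ | ∃ s t : ℝ, 0 ≤ s ∧ s < t ∧ t ≤ T ∧ r = ‖f t - f s‖ / (t - s) ^ α}

/-- A simple function: finitely many values, measurable level sets. -/
def IsSimpleFunc {S E : Type*} [MeasurableSpace S] (f : S → E) : Prop :=
  (Set.range f).Finite ∧ ∀ e : E, MeasurableSet (f ⁻¹' {e})

section Sewing

variable {V : Type*} [NormedAddCommGroup V]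

/-- The constant `1 / (1 - 2^(1-β))` of the sewing lemma. -/
noncomputable def sewingConst (β : ℝ) : ℝ := (1 - (2 : ℝ) ^ (1 - β))⁻¹

lemma two_rpow_one_sub_lt_one {β : ℝ} (hβ : 1 < β) : (2 : ℝ) ^ (1 - β) < 1 :=
  Real.rpow_lt_one_of_one_lt_of_neg (by norm_num) (by linarith)

lemma sewingConst_nonneg {β : ℝ} (hβ : 1 < β) : 0 ≤ sewingConst β :=
  inv_nonneg.2 (sub_nonneg.2 (two_rpow_one_sub_lt_one hβ).le)

lemma two_mul_half_rpow {β x : ℝ} (hx : 0 ≤ x) :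
    2 * (x / 2) ^ β = (2 : ℝ) ^ (1 - β) * x ^ β := by
  rw [Real.div_rpow hx (by norm_num), Real.rpow_sub (by norm_num), Real.rpow_one]
  ring

lemma sewingConst_mul_add {β x : ℝ} (hβ : 1 < β) (hx : 0 ≤ x) :
    2 * (sewingConst β * (x / 2) ^ β) + x ^ β = sewingConst β * x ^ β := by
  have h1 : sewingConst β * (1 - (2 : ℝ) ^ (1 - β)) = 1 :=
    inv_mul_cancel₀ (sub_pos.2 (two_rpow_one_sub_lt_one hβ)).ne'
  linear_combination sewingConst β * two_mul_half_rpow (β := β) hx - x ^ β * h1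

lemma two_pow_mul_div_rpow {β T : ℝ} (hT : 0 ≤ T) (n : ℕ) :
    (2 : ℝ) ^ n * (T / 2 ^ n) ^ β = T ^ β * ((2 : ℝ) ^ (1 - β)) ^ n := by
  induction n with
  | zero => simp
  | succ n ih =>
    have h := two_mul_half_rpow (β := β) (x := T / 2 ^ n) (by positivity)
    rw [div_div, ← pow_succ] at h
    rw [pow_succ ((2 : ℝ) ^ (1 - β)), ← mul_assoc, ← ih, pow_succ, mul_assoc (2 ^ n : ℝ),
      ← pow_succ, h]
    ring

lemma tendsto_two_pow_mul_div_rpow {β T : ℝ} (hβ : 1 < β) (hT : 0 ≤ T) :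
    Filter.Tendsto (fun n : ℕ => (2 : ℝ) ^ n * (T / 2 ^ n) ^ β) Filter.atTop (nhds 0) := by
  simp_rw [two_pow_mul_div_rpow hT]
  simpa using (tendsto_pow_atTop_nhds_zero_of_lt_one (by positivity)
    (two_rpow_one_sub_lt_one hβ)).const_mul (T ^ β)

/-- An almost additive two-parameter function that is small on short intervals is controlled on
long ones, by repeated bisection. -/
lemma norm_le_of_almost_additive {β T M ε h : ℝ} (hβ : 1 < β) (hM : 0 ≤ M) {R : ℝ → ℝ → V}
    (hR : ∀ s u t : ℝ, 0 ≤ s → s ≤ u → u ≤ t → t ≤ T →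
      ‖R s t - R s u - R u t‖ ≤ M * (t - s) ^ β)
    (hε : ∀ s t : ℝ, 0 ≤ s → s ≤ t → t ≤ T → t - s ≤ h → ‖R s t‖ ≤ ε) (j : ℕ) :
    ∀ s t : ℝ, 0 ≤ s → s ≤ t → t ≤ T → t - s ≤ 2 ^ j * h →
      ‖R s t‖ ≤ 2 ^ j * ε + sewingConst β * M * (t - s) ^ β := by
  induction j with
  | zero =>
    intro s t hs hst ht hj
    have h1 := hε s t hs hst ht (by simpa using hj)
    have h2 : 0 ≤ sewingConst β * M * (t - s) ^ β :=
      mul_nonneg (mul_nonneg (sewingConst_nonneg hβ) hM) (Real.rpow_nonneg (by linarith) _)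
    simpa using h1.trans (le_add_of_nonneg_right h2)
  | succ j ih =>
    intro s t hs hst ht hj
    rw [pow_succ] at hj ⊢
    have h1 := ih s ((s + t) / 2) hs (by linarith) (by linarith) (by linarith)
    have h2 := ih ((s + t) / 2) t (by linarith) (by linarith) ht (by linarith)
    have h3 := hR s ((s + t) / 2) t hs (by linarith) (by linarith) ht
    rw [show (s + t) / 2 - s = (t - s) / 2 by ring] at h1
    rw [show t - (s + t) / 2 = (t - s) / 2 by ring] at h2
    have h4 := sewingConst_mul_add hβ (sub_nonneg.2 hst)
    have h5 : ‖R s t‖ ≤ ‖R s t - R s ((s + t) / 2) - R ((s + t) / 2) t‖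
        + ‖R s ((s + t) / 2)‖ + ‖R ((s + t) / 2) t‖ := by
      calc ‖R s t‖ = ‖(R s t - R s ((s + t) / 2) - R ((s + t) / 2) t)
            + R s ((s + t) / 2) + R ((s + t) / 2) t‖ := by congr 1; abel
        _ ≤ _ := norm_add₃_le
    have h6 : 2 * (sewingConst β * M * ((t - s) / 2) ^ β) + M * (t - s) ^ β
        = sewingConst β * M * (t - s) ^ β := by linear_combination M * h4
    linarith

lemma norm_remainder_sub_le {β T M : ℝ} {γ : ℝ → ℝ → V}
    (hγ : ∀ s u t : ℝ, 0 ≤ s → s ≤ u → u ≤ t → t ≤ T →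
      ‖γ s t - γ s u - γ u t‖ ≤ M * (t - s) ^ β) (f : ℝ → V) (s u t : ℝ)
    (hs : 0 ≤ s) (hsu : s ≤ u) (hut : u ≤ t) (ht : t ≤ T) :
    ‖(f t - f s - γ s t) - (f u - f s - γ s u) - (f t - f u - γ u t)‖ ≤ M * (t - s) ^ β := by
  refine le_of_eq_of_le ?_ (hγ s u t hs hsu hut ht)
  rw [← norm_neg]
  congr 1
  abel

/-- Any path sewing `γ` up to order `β` does so with the optimal constant. -/
lemma sewing_bound {β T M K : ℝ} (hβ : 1 < β) (hT : 0 ≤ T) (hM : 0 ≤ M) {γ : ℝ → ℝ → V}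
    (hγ : ∀ s u t : ℝ, 0 ≤ s → s ≤ u → u ≤ t → t ≤ T →
      ‖γ s t - γ s u - γ u t‖ ≤ M * (t - s) ^ β) {f : ℝ → V}
    (hf : ∀ s t : ℝ, 0 ≤ s → s ≤ t → t ≤ T → ‖f t - f s - γ s t‖ ≤ K * (t - s) ^ β)
    {s t : ℝ} (hs : 0 ≤ s) (hst : s ≤ t) (ht : t ≤ T) :
    ‖f t - f s - γ s t‖ ≤ sewingConst β * M * (t - s) ^ β := by
  have key (n : ℕ) : ‖f t - f s - γ s t‖
      ≤ |K| * (2 ^ n * (T / 2 ^ n) ^ β) + sewingConst β * M * (t - s) ^ β := by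
    have := norm_le_of_almost_additive (h := T / 2 ^ n) (ε := |K| * (T / 2 ^ n) ^ β) hβ hM
      (R := fun s t => f t - f s - γ s t) (norm_remainder_sub_le hγ f)
      (fun u v hu huv hv hh => (hf u v hu huv hv).trans <| by
        have : 0 ≤ v - u := sub_nonneg.2 huv
        gcongr
        exact le_abs_self K) n s t hs hst ht (by
          rw [mul_div_cancel₀ _ (by positivity)]; linarith)
    linarith
  refine ge_of_tendsto' (f := fun n : ℕ => |K| * (2 ^ n * (T / 2 ^ n) ^ β)
    + sewingConst β * M * (t - s) ^ β) (x := Filter.atTop) ?_ key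
  simpa using ((tendsto_two_pow_mul_div_rpow hβ hT).const_mul |K|).add_const
    (sewingConst β * M * (t - s) ^ β)

/-- The Riemann sum of `γ` along the grid of step `h`, run up to time `t`. -/
noncomputable def gridSum (γ : ℝ → ℝ → V) (h t : ℝ) : V :=
  ∑ i ∈ Finset.range ⌊t / h⌋₊, γ (i * h) ((i + 1) * h) + γ (⌊t / h⌋₊ * h) t

lemma norm_gridSum_remainder_le {β T M h : ℝ} (hβ : 1 < β) (hh : 0 < h) (hM : 0 ≤ M)
    {γ : ℝ → ℝ → V}
    (hγ : ∀ s u t : ℝ, 0 ≤ s → s ≤ u → u ≤ t → t ≤ T →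
      ‖γ s t - γ s u - γ u t‖ ≤ M * (t - s) ^ β)
    {s t : ℝ} (hs : 0 ≤ s) (hst : s ≤ t) (ht : t ≤ T) (hle : t - s ≤ h) :
    ‖gridSum γ h t - gridSum γ h s - γ s t‖ ≤ 2 * M * h ^ β := by
  have hs0 : 0 ≤ s / h := by positivity
  have ht0 : 0 ≤ t / h := div_nonneg (hs.trans hst) hh.le
  have ha : ⌊s / h⌋₊ * h ≤ s := (le_div_iff₀ hh).1 (Nat.floor_le hs0)
  have hb : s < (⌊s / h⌋₊ + 1) * h := (div_lt_iff₀ hh).1 (Nat.lt_floor_add_one _)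
  have hb' : t < (⌊t / h⌋₊ + 1) * h := (div_lt_iff₀ hh).1 (Nat.lt_floor_add_one _)
  have hc : ⌊t / h⌋₊ * h ≤ t := (le_div_iff₀ hh).1 (Nat.floor_le ht0)
  have ha0 : 0 ≤ ⌊s / h⌋₊ * h := by positivity
  have h1 : ⌊s / h⌋₊ ≤ ⌊t / h⌋₊ := Nat.floor_le_floor (by gcongr)
  have h2 : ⌊t / h⌋₊ ≤ ⌊s / h⌋₊ + 1 := by
    rw [← Nat.floor_add_one hs0]
    apply Nat.floor_le_floor
    rw [div_add_one hh.ne']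
    gcongr
    linarith
  have hmono {x : ℝ} (hx : 0 ≤ x) (hxh : x ≤ h) : M * x ^ β ≤ M * h ^ β := by gcongr
  unfold gridSum
  obtain h3 | h3 : ⌊t / h⌋₊ = ⌊s / h⌋₊ ∨ ⌊t / h⌋₊ = ⌊s / h⌋₊ + 1 := by omega
  · rw [h3] at hb' ⊢
    have h4 := (hγ _ s t ha0 ha hst ht).trans (hmono (by linarith) (by linarith))
    have h5 : 0 ≤ M * h ^ β := by positivity
    calc _ = ‖γ (⌊s / h⌋₊ * h) t - γ (⌊s / h⌋₊ * h) s - γ s t‖ := by congr 1; abel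
      _ ≤ _ := by linarith
  · rw [h3] at hc ⊢
    push_cast at hc ⊢
    rw [Finset.sum_range_succ]
    set a := ⌊s / h⌋₊ * h
    set b := (⌊s / h⌋₊ + 1) * h
    have hab : b = a + h := by simp only [a, b]; ring
    have h4 := (hγ a s b ha0 ha hb.le (by linarith)).trans (hmono (by linarith) (by linarith))
    have h5 := (hγ s b t hs hb.le hc ht).trans (hmono (by linarith) (by linarith))
    calc _ = ‖(γ a b - γ a s - γ s b) - (γ s t - γ s b - γ b t)‖ := by congr 1; abel
      _ ≤ ‖γ a b - γ a s - γ s b‖ + ‖γ s t - γ s b - γ b t‖ := norm_sub_le _ _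
      _ ≤ _ := by linarith

/-- The increments of two nested dyadic Riemann sums differ little. -/
lemma norm_gridSum_sub_le {β T M : ℝ} (hβ : 1 < β) (hT : 0 < T) (hM : 0 ≤ M) {γ : ℝ → ℝ → V}
    (hγ : ∀ s u t : ℝ, 0 ≤ s → s ≤ u → u ≤ t → t ≤ T →
      ‖γ s t - γ s u - γ u t‖ ≤ M * (t - s) ^ β) (h0 : γ 0 0 = 0)
    {n m : ℕ} (hnm : n ≤ m) {t : ℝ} (ht0 : 0 ≤ t) (ht : t ≤ T) :
    ‖gridSum γ (T / 2 ^ m) t - gridSum γ (T / 2 ^ n) t‖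
      ≤ (4 + sewingConst β) * M * (2 ^ n * (T / 2 ^ n) ^ β) := by
  obtain ⟨k, rfl⟩ := Nat.exists_eq_add_of_le hnm
  set D : ℝ → V := fun t => gridSum γ (T / 2 ^ (n + k)) t - gridSum γ (T / 2 ^ n) t with hD
  have hD0 : D 0 = 0 := by simp [hD, gridSum, h0]
  have hC := sewingConst_nonneg hβ
  have hshort : ∀ s t : ℝ, 0 ≤ s → s ≤ t → t ≤ T → t - s ≤ T / 2 ^ n →
      ‖D t - D s‖ ≤ (4 + sewingConst β) * M * (T / 2 ^ n) ^ β := by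
    intro s t hs hst ht hle
    have h1 := norm_gridSum_remainder_le hβ (h := T / 2 ^ n) (by positivity) hM hγ hs hst ht hle
    have h2 := norm_le_of_almost_additive hβ hM
      (R := fun s t => gridSum γ (T / 2 ^ (n + k)) t - gridSum γ (T / 2 ^ (n + k)) s - γ s t)
      (norm_remainder_sub_le hγ _)
      (fun u v hu huv hv hh =>
        norm_gridSum_remainder_le hβ (h := T / 2 ^ (n + k)) (by positivity) hM hγ hu huv hv hh)
      k s t hs hst ht (by rw [pow_add, ← div_div, mul_div_cancel₀ _ (by positivity)]; exact hle)
    have h3 : (2 : ℝ) ^ k * (T / 2 ^ (n + k)) ^ β ≤ (T / 2 ^ n) ^ β := by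
      rw [pow_add, ← div_div, two_pow_mul_div_rpow (by positivity)]
      exact mul_le_of_le_one_right (by positivity)
        (pow_le_one₀ (by positivity) (two_rpow_one_sub_lt_one hβ).le)
    have h4 : sewingConst β * M * (t - s) ^ β ≤ sewingConst β * M * (T / 2 ^ n) ^ β := by
      have : 0 ≤ t - s := sub_nonneg.2 hst
      gcongr
    have h5 := mul_le_mul_of_nonneg_left h3 hM
    calc ‖D t - D s‖ = ‖(gridSum γ (T / 2 ^ (n + k)) t - gridSum γ (T / 2 ^ (n + k)) s - γ s t)
          - (gridSum γ (T / 2 ^ n) t - gridSum γ (T / 2 ^ n) s - γ s t)‖ := by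
            simp only [hD]; congr 1; abel
      _ ≤ _ := norm_sub_le _ _
      _ ≤ _ := by linarith
  have := norm_le_of_almost_additive (M := 0) hβ le_rfl (R := fun s t => D t - D s)
    (fun s u t _ _ _ _ => by simp) hshort n 0 t le_rfl ht0 ht
    (by rw [mul_div_cancel₀ _ (by positivity)]; linarith)
  simp only [hD0, sub_zero, mul_zero, zero_mul, add_zero] at this
  exact this.trans_eq (by ring)

/-- The sewing lemma: existence of the sewing with a quantitative bound. -/
lemma exists_sewing [CompleteSpace V] {β T M : ℝ} (hβ : 1 < β) (hT : 0 < T) (hM : 0 ≤ M)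
    {γ : ℝ → ℝ → V}
    (hγ : ∀ s u t : ℝ, 0 ≤ s → s ≤ u → u ≤ t → t ≤ T →
      ‖γ s t - γ s u - γ u t‖ ≤ M * (t - s) ^ β) (h0 : γ 0 0 = 0) :
    ∃ f : ℝ → V, f 0 = 0 ∧ ∀ s t : ℝ, 0 ≤ s → s ≤ t → t ≤ T →
      ‖f t - f s - γ s t‖ ≤ sewingConst β * M * (t - s) ^ β := by
  have hlim : ∀ t : ℝ, ∃ l : V, 0 ≤ t → t ≤ T →
      Filter.Tendsto (fun n : ℕ => gridSum γ (T / 2 ^ n) t) Filter.atTop (nhds l) := by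
    intro t
    by_cases h : 0 ≤ t ∧ t ≤ T
    · have hb : Filter.Tendsto
          (fun n : ℕ => (4 + sewingConst β) * M * ((2 : ℝ) ^ n * (T / 2 ^ n) ^ β))
          Filter.atTop (nhds 0) := by
        simpa using (tendsto_two_pow_mul_div_rpow hβ hT.le).const_mul
          ((4 + sewingConst β) * M)
      have hc : CauchySeq (fun n : ℕ => gridSum γ (T / 2 ^ n) t) := by
        refine cauchySeq_of_le_tendsto_0'
          (fun n : ℕ => (4 + sewingConst β) * M * ((2 : ℝ) ^ n * (T / 2 ^ n) ^ β)) ?_ hb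
        intro n m hnm
        rw [dist_comm, dist_eq_norm]
        exact norm_gridSum_sub_le hβ hT hM hγ h0 hnm h.1 h.2
      obtain ⟨l, hl⟩ := cauchySeq_tendsto_of_complete hc
      exact ⟨l, fun _ _ => hl⟩
    · exact ⟨0, fun h1 h2 => absurd ⟨h1, h2⟩ h⟩
  choose f hf using hlim
  refine ⟨f, ?_, ?_⟩
  · refine tendsto_nhds_unique (hf 0 le_rfl hT.le) ?_
    simp [gridSum, h0]
  · intro s t hs hst ht
    have h1 := (((hf t (hs.trans hst) ht).sub (hf s hs (hst.trans ht))).sub_const (γ s t)).norm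
    have h2 : Filter.Tendsto (fun n : ℕ => 2 * M * ((2 : ℝ) ^ n * (T / 2 ^ n) ^ β)
        + sewingConst β * M * (t - s) ^ β) Filter.atTop
        (nhds (sewingConst β * M * (t - s) ^ β)) := by
      simpa using ((tendsto_two_pow_mul_div_rpow hβ hT.le).const_mul (2 * M)).add_const
        (sewingConst β * M * (t - s) ^ β)
    refine le_of_tendsto_of_tendsto' h1 h2 fun n => ?_
    have := norm_le_of_almost_additive hβ hM
      (R := fun s t => gridSum γ (T / 2 ^ n) t - gridSum γ (T / 2 ^ n) s - γ s t)
      (norm_remainder_sub_le hγ _)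
      (fun u v hu huv hv hh =>
        norm_gridSum_remainder_le hβ (h := T / 2 ^ n) (by positivity) hM hγ hu huv hv hh)
      n s t hs hst ht (by rw [mul_div_cancel₀ _ (by positivity)]; linarith)
    linarith

namespace HasGermBounds

variable {α β T M N : ℝ} {γ γ' : ℝ → ℝ → V}

lemma nonneg (h : HasGermBounds α β T γ M) (hT : 0 < T) : 0 ≤ M := by
  have h1 := (norm_nonneg _).trans (h.1 0 T le_rfl hT.le le_rfl)
  exact nonneg_of_mul_nonneg_left h1 (by rw [sub_zero]; positivity)

lemma diag (h : HasGermBounds α β T γ M) (hα : 0 < α) {t : ℝ} (h0 : 0 ≤ t) (ht : t ≤ T) :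
    γ t t = 0 := by
  have := h.1 t t h0 le_rfl ht
  rwa [sub_self, Real.zero_rpow hα.ne', mul_zero, norm_le_zero_iff] at this

lemma of_sub (h : HasGermBounds α β T γ M)
    (h' : HasGermBounds α β T (fun s t => γ s t - γ' s t) N) :
    HasGermBounds α β T γ' (M + N) := by
  constructor
  · intro s t hs hst ht
    have h1 := h.1 s t hs hst ht
    have h2 := h'.1 s t hs hst ht
    calc ‖γ' s t‖ = ‖γ s t - (γ s t - γ' s t)‖ := by congr 1; abel
      _ ≤ _ := norm_sub_le _ _
      _ ≤ _ := by linarith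
  · intro s u t hs hsu hut ht
    have h1 := h.2 s u t hs hsu hut ht
    have h2 := h'.2 s u t hs hsu hut ht
    calc ‖γ' s t - γ' s u - γ' u t‖ = ‖(γ s t - γ s u - γ u t)
          - ((γ s t - γ' s t) - (γ s u - γ' s u) - (γ u t - γ' u t))‖ := by congr 1; abel
      _ ≤ _ := norm_sub_le _ _
      _ ≤ _ := by linarith

lemma div_add_div_le_germNorm (h : HasGermBounds α β T γ M) {s t s' u' t' : ℝ}
    (hs : 0 ≤ s) (hst : s < t) (ht : t ≤ T)
    (hs' : 0 ≤ s') (hsu' : s' ≤ u') (hut' : u' ≤ t') (hst' : s' < t') (ht' : t' ≤ T) :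
    ‖γ s t‖ / (t - s) ^ α + ‖γ s' t' - γ s' u' - γ u' t'‖ / (t' - s') ^ β
      ≤ germNorm α β T γ := by
  refine add_le_add (le_csSup ⟨M, ?_⟩ ⟨s, t, hs, hst, ht, rfl⟩)
    (le_csSup ⟨M, ?_⟩ ⟨s', u', t', hs', hsu', hut', ht', hst', rfl⟩)
  · rintro _ ⟨s, t, hs, hst, ht, rfl⟩
    exact (div_le_iff₀ (Real.rpow_pos_of_pos (sub_pos.2 hst) _)).2 (h.1 s t hs hst.le ht)
  · rintro _ ⟨s, u, t, hs, hsu, hut, ht, hst, rfl⟩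
    exact (div_le_iff₀ (Real.rpow_pos_of_pos (sub_pos.2 hst) _)).2 (h.2 s u t hs hsu hut ht)

/-- The germ norm is itself an admissible constant. -/
lemma germNorm_bounds (h : HasGermBounds α β T γ M) (hα : 0 < α) (hβ : 1 < β) :
    HasGermBounds α β T γ (germNorm α β T γ) := by
  constructor
  · intro s t hs hst ht
    rcases hst.eq_or_lt with rfl | hlt
    · simp [h.diag hα hs ht, Real.zero_rpow hα.ne']
    · have h1 := h.div_add_div_le_germNorm hs hlt ht hs le_rfl hst hlt ht
      have h2 := Real.rpow_pos_of_pos (sub_pos.2 hlt) β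
      rw [← div_le_iff₀ (Real.rpow_pos_of_pos (sub_pos.2 hlt) _)]
      exact (le_add_of_nonneg_right (by positivity)).trans h1
  · intro s u t hs hsu hut ht
    rcases (hsu.trans hut).eq_or_lt with rfl | hlt
    · simpa [Real.zero_rpow (by linarith : β ≠ 0)] using h.2 s u s hs hsu hut ht
    · have h1 := h.div_add_div_le_germNorm hs hlt ht hs hsu hut hlt ht
      have h2 := Real.rpow_pos_of_pos (sub_pos.2 hlt) α
      rw [← div_le_iff₀ (Real.rpow_pos_of_pos (sub_pos.2 hlt) _)]
      exact (le_add_of_nonneg_left (by positivity)).trans h1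

lemma exists_sewing [CompleteSpace V] (h : HasGermBounds α β T γ M) (hα : 0 < α) (hβ : 1 < β)
    (hT : 0 < T) :
    ∃ f : ℝ → V, f 0 = 0 ∧ ∀ s t : ℝ, 0 ≤ s → s ≤ t → t ≤ T →
      ‖f t - f s - γ s t‖ ≤ sewingConst β * germNorm α β T γ * (t - s) ^ β :=
  have h' := h.germNorm_bounds hα hβ
  _root_.exists_sewing hβ hT (h'.nonneg hT) h'.2 (h.diag hα le_rfl hT.le)

/-- Any sewing of `γ` is Hölder, with a constant proportional to the germ norm. -/
lemma norm_sewing_sub_le (h : HasGermBounds α β T γ M) (hα : 0 < α) (hα1 : α < 1) (hβ : 1 < β)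
    (hT : 0 < T) {f : ℝ → V} {K : ℝ}
    (hf : ∀ s t : ℝ, 0 ≤ s → s ≤ t → t ≤ T → ‖f t - f s - γ s t‖ ≤ K * (t - s) ^ β)
    {s t : ℝ} (hs : 0 ≤ s) (hst : s ≤ t) (ht : t ≤ T) :
    ‖f t - f s‖ ≤ germNorm α β T γ * (1 + sewingConst β * T ^ (β - α)) * (t - s) ^ α := by
  have h' := h.germNorm_bounds hα hβ
  have hN := h'.nonneg hT
  have hC := sewingConst_nonneg hβ
  have h0 : 0 ≤ t - s := sub_nonneg.2 hst
  have h1 := sewing_bound hβ hT.le hN h'.2 hf hs hst ht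
  have h2 := h'.1 s t hs hst ht
  have h3 : (t - s) ^ β ≤ T ^ (β - α) * (t - s) ^ α := by
    rcases h0.eq_or_lt with h0 | h0
    · simp [← h0, Real.zero_rpow hα.ne', Real.zero_rpow (by linarith : β ≠ 0)]
    · calc (t - s) ^ β = (t - s) ^ (β - α) * (t - s) ^ α := by
            rw [← Real.rpow_add h0]; ring_nf
        _ ≤ _ := by
            gcongr
            linarith
            linarith
  have h4 := mul_le_mul_of_nonneg_left h3 (mul_nonneg hC hN)
  calc ‖f t - f s‖ = ‖(f t - f s - γ s t) + γ s t‖ := by congr 1; abel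
    _ ≤ _ := norm_add_le _ _
    _ ≤ _ := by linarith

end HasGermBounds

lemma germNorm_le {α β T c : ℝ} (hT : 0 < T) {γ : ℝ → ℝ → V}
    (h : ∀ s t s' u' t' : ℝ, 0 ≤ s → s < t → t ≤ T → 0 ≤ s' → s' ≤ u' → u' ≤ t' → s' < t' →
      t' ≤ T →
      ‖γ s t‖ / (t - s) ^ α + ‖γ s' t' - γ s' u' - γ u' t'‖ / (t' - s') ^ β ≤ c) :
    germNorm α β T γ ≤ c := by
  refine le_sub_iff_add_le.1 (csSup_le ⟨_, 0, T, le_rfl, hT, le_rfl, rfl⟩ ?_)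
  rintro _ ⟨s, t, hs, hst, ht, rfl⟩
  refine le_sub_comm.1 (csSup_le ⟨_, 0, 0, T, le_rfl, le_rfl, hT.le, le_rfl, hT, rfl⟩ ?_)
  rintro _ ⟨s', u', t', hs', hsu', hut', ht', hst', rfl⟩
  exact le_sub_iff_add_le'.2 (h s t s' u' t' hs hst ht hs' hsu' hut' hst' ht')

lemma pathNorm_nonneg (α T : ℝ) (f : ℝ → V) : 0 ≤ pathNorm α T f := by
  refine add_nonneg (Real.sSup_nonneg ?_) (Real.sSup_nonneg ?_)
  · rintro _ ⟨t, -, -, rfl⟩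
    positivity
  · rintro _ ⟨s, t, -, hst, -, rfl⟩
    have := Real.rpow_pos_of_pos (sub_pos.2 hst) α
    positivity

lemma norm_le_of_holder {α T L : ℝ} (hα : 0 < α) (hL : 0 ≤ L) {f : ℝ → V} (h0 : f 0 = 0)
    (hf : ∀ s t : ℝ, 0 ≤ s → s ≤ t → t ≤ T → ‖f t - f s‖ ≤ L * (t - s) ^ α)
    {t : ℝ} (ht0 : 0 ≤ t) (ht : t ≤ T) : ‖f t‖ ≤ L * T ^ α := by
  have := hf 0 t le_rfl ht0 ht
  rw [h0, sub_zero, sub_zero] at this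
  exact this.trans (by gcongr)

lemma pathNorm_le_of_holder {α T L : ℝ} (hα : 0 < α) (hT : 0 < T) (hL : 0 ≤ L) {f : ℝ → V}
    (h0 : f 0 = 0)
    (hf : ∀ s t : ℝ, 0 ≤ s → s ≤ t → t ≤ T → ‖f t - f s‖ ≤ L * (t - s) ^ α) :
    pathNorm α T f ≤ L * (T ^ α + 1) := by
  rw [mul_add, mul_one]
  refine add_le_add (Real.sSup_le ?_ (by positivity)) (Real.sSup_le ?_ hL)
  · rintro _ ⟨t, ht0, ht, rfl⟩
    exact norm_le_of_holder hα hL h0 hf ht0 ht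
  · rintro _ ⟨s, t, hs, hst, ht, rfl⟩
    exact (div_le_iff₀ (Real.rpow_pos_of_pos (sub_pos.2 hst) _)).2 (hf s t hs hst.le ht)

lemma IsSimpleFunc.comp {S E F : Type*} [MeasurableSpace S] {f : S → E} (hf : IsSimpleFunc f)
    (g : E → F) : IsSimpleFunc (fun x => g (f x)) := by
  refine ⟨?_, fun e => ?_⟩
  · rw [show (fun x => g (f x)) = g ∘ f from rfl, Set.range_comp]
    exact hf.1.image g
  · have : (fun x => g (f x)) ⁻¹' {e} = ⋃ y ∈ Set.range f ∩ g ⁻¹' {e}, f ⁻¹' {y} := by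
      ext x
      simp
    rw [this]
    exact (hf.1.inter_of_left _).measurableSet_biUnion fun y _ => hf.2 y

lemma IsSimpleFunc.stronglyMeasurable {S : Type*} [MeasurableSpace S] {f : S → V}
    (hf : IsSimpleFunc f) : StronglyMeasurable f :=
  SimpleFunc.stronglyMeasurable ⟨f, hf.2, hf.1⟩

lemma integral_sub_sub [NormedSpace ℝ V] {S : Type*} [MeasurableSpace S] {μ : Measure S}
    {f g h : S → V} (hf : Integrable f μ) (hg : Integrable g μ) (hh : Integrable h μ) :
    (∫ x, f x ∂μ) - (∫ x, g x ∂μ) - ∫ x, h x ∂μ = ∫ x, (f x - g x - h x) ∂μ := by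
  rw [← integral_sub hf hg]
  exact (integral_sub (hf.sub hg) hh).symm

end Sewing

/-- **Fubini theorem for the sewing map.**  Let `0 < α < 1 < β`, `V` a separable Banach
space, `(S,𝒜,μ)` a measure space and `Γ : S → C₂^{α,β}([0,T];V)` strongly measurable with
`∫ ‖Γ(θ)‖_{α,β} dμ < ∞`.  Then `θ ↦ 𝒥(Γ(θ))` is strongly measurable into `C^α([0,T];V)`,
the pointwise Bochner integrals `Γ̄_{s,t} = ∫ Γ(θ)_{s,t} dμ` define an element of
`C₂^{α,β}` with `‖Γ̄‖_{α,β} ≤ ∫ ‖Γ(θ)‖_{α,β} dμ`, and `𝒥(Γ̄)_t = ∫ 𝒥(Γ(θ))_t dμ`. -/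
theorem sewing_fubini
    {V : Type*} [NormedAddCommGroup V] [NormedSpace ℝ V] [CompleteSpace V]
    [TopologicalSpace.SeparableSpace V] [MeasurableSpace V] [BorelSpace V]
    (α β T : ℝ) (hα0 : 0 < α) (hα1 : α < 1) (hβ : 1 < β) (hT : 0 < T)
    {S : Type*} [MeasurableSpace S] (μ : Measure S)
    (Γ : S → ℝ → ℝ → V)
    (hdiag : ∀ θ : S, ∀ t : ℝ, 0 ≤ t → t ≤ T → Γ θ t t = 0)
    (hfin : ∀ θ : S, ∃ M : ℝ, HasGermBounds α β T (Γ θ) M)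
    (hmeas : ∃ F : ℕ → S → (ℝ → ℝ → V),
      (∀ n, IsSimpleFunc (F n)) ∧
      (∀ n : ℕ, ∀ θ : S, ∃ M : ℝ,
        HasGermBounds α β T (fun s t => Γ θ s t - F n θ s t) M) ∧
      (∀ θ : S, Filter.Tendsto
        (fun n => germNorm α β T (fun s t => Γ θ s t - F n θ s t))
        Filter.atTop (nhds 0)))
    (hint : Integrable (fun θ => germNorm α β T (Γ θ)) μ) :
    ∃ J : S → ℝ → V,
      -- J θ is the sewing of Γ θ
      (∀ θ : S, J θ 0 = 0 ∧ ∃ K : ℝ, ∀ s t : ℝ, 0 ≤ s → s ≤ t → t ≤ T →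
        ‖J θ t - J θ s - Γ θ s t‖ ≤ K * (t - s) ^ β) ∧
      -- θ ↦ J θ is strongly measurable into C^α([0,T];V)
      (∃ G : ℕ → S → (ℝ → V),
        (∀ n, IsSimpleFunc (G n)) ∧
        (∀ n : ℕ, ∀ θ : S, ∃ K : ℝ,
          (∀ t : ℝ, 0 ≤ t → t ≤ T → ‖J θ t - G n θ t‖ ≤ K) ∧
          (∀ s t : ℝ, 0 ≤ s → s ≤ t → t ≤ T →
            ‖(J θ t - G n θ t) - (J θ s - G n θ s)‖ ≤ K * (t - s) ^ α)) ∧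
        (∀ θ : S, Filter.Tendsto
          (fun n => pathNorm α T (fun t => J θ t - G n θ t))
          Filter.atTop (nhds 0))) ∧
      -- the pointwise Bochner integrals define an element Γ̄ of C₂^{α,β}
      (∀ s t : ℝ, 0 ≤ s → s ≤ t → t ≤ T → Integrable (fun θ => Γ θ s t) μ) ∧
      (∃ Mbar : ℝ, HasGermBounds α β T (fun s t => ∫ θ, Γ θ s t ∂μ) Mbar) ∧
      germNorm α β T (fun s t => ∫ θ, Γ θ s t ∂μ) ≤ ∫ θ, germNorm α β T (Γ θ) ∂μ ∧
      -- the sewing commutes with the integral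
      (∀ t : ℝ, 0 ≤ t → t ≤ T → Integrable (fun θ => J θ t) μ) ∧
      (∃ Ibar : ℝ → V,
        Ibar 0 = 0 ∧
        (∃ K : ℝ, ∀ s t : ℝ, 0 ≤ s → s ≤ t → t ≤ T →
          ‖Ibar t - Ibar s - ∫ θ, Γ θ s t ∂μ‖ ≤ K * (t - s) ^ β) ∧
        (∀ t : ℝ, 0 ≤ t → t ≤ T → Ibar t = ∫ θ, J θ t ∂μ)) := by
  obtain ⟨F, hF, hFb, hFlim⟩ := hmeas
  set C := sewingConst β
  set A := 1 + C * T ^ (β - α)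
  have hC : 0 ≤ C := sewingConst_nonneg hβ
  have hA : 0 ≤ A := by positivity
  have hsew : ∀ γ : ℝ → ℝ → V, ∃ f : ℝ → V, (∃ M, HasGermBounds α β T γ M) →
      f 0 = 0 ∧ ∀ s t : ℝ, 0 ≤ s → s ≤ t → t ≤ T →
        ‖f t - f s - γ s t‖ ≤ C * germNorm α β T γ * (t - s) ^ β := by
    intro γ
    by_cases h : ∃ M, HasGermBounds α β T γ M
    · obtain ⟨f, hf⟩ := h.choose_spec.exists_sewing hα0 hβ hT
      exact ⟨f, fun _ => hf⟩
    · exact ⟨0, fun h' => absurd h' h⟩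
  choose sew hsew using hsew
  have hFn (n : ℕ) (θ : S) : ∃ M, HasGermBounds α β T (F n θ) M := by
    obtain ⟨M, hM⟩ := hfin θ
    obtain ⟨N, hN⟩ := hFb n θ
    exact ⟨_, hM.of_sub hN⟩
  have hJ0 (θ : S) := (hsew (Γ θ) (hfin θ)).1
  have hJ (θ : S) := (hsew (Γ θ) (hfin θ)).2
  have hΓ (θ : S) : HasGermBounds α β T (Γ θ) (germNorm α β T (Γ θ)) :=
    (hfin θ).choose_spec.germNorm_bounds hα0 hβ
  have hd (n : ℕ) (θ : S) : HasGermBounds α β T (fun s t => Γ θ s t - F n θ s t)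
      (germNorm α β T (fun s t => Γ θ s t - F n θ s t)) :=
    (hFb n θ).choose_spec.germNorm_bounds hα0 hβ
  have hD0 (n : ℕ) (θ : S) : sew (Γ θ) 0 - sew (F n θ) 0 = 0 := by
    rw [hJ0, (hsew (F n θ) (hFn n θ)).1, sub_zero]
  have hDh (n : ℕ) (θ : S) (s t : ℝ) (hs : 0 ≤ s) (hst : s ≤ t) (ht : t ≤ T) :
      ‖(sew (Γ θ) t - sew (F n θ) t) - (sew (Γ θ) s - sew (F n θ) s)‖
        ≤ germNorm α β T (fun s t => Γ θ s t - F n θ s t) * A * (t - s) ^ α := by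
    refine (hd n θ).norm_sewing_sub_le hα0 hα1 hβ hT
      (f := fun t => sew (Γ θ) t - sew (F n θ) t)
      (K := C * germNorm α β T (Γ θ) + C * germNorm α β T (F n θ)) ?_ hs hst ht
    intro s t hs hst ht
    have h1 := hJ θ s t hs hst ht
    have h2 := (hsew (F n θ) (hFn n θ)).2 s t hs hst ht
    calc _ = ‖(sew (Γ θ) t - sew (Γ θ) s - Γ θ s t)
          - (sew (F n θ) t - sew (F n θ) s - F n θ s t)‖ := by congr 1; abel
      _ ≤ _ := norm_sub_le _ _
      _ ≤ _ := by linarith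
  have hL (n : ℕ) (θ : S) : 0 ≤ germNorm α β T (fun s t => Γ θ s t - F n θ s t) * A :=
    mul_nonneg ((hd n θ).nonneg hT) hA
  have hscale (θ : S) (c : ℝ) : Filter.Tendsto
      (fun n => germNorm α β T (fun s t => Γ θ s t - F n θ s t) * A * c)
      Filter.atTop (nhds 0) := by
    simpa using ((hFlim θ).mul_const A).mul_const c
  have hΓint : ∀ s t : ℝ, 0 ≤ s → s ≤ t → t ≤ T → Integrable (fun θ => Γ θ s t) μ := by
    intro s t hs hst ht
    refine (hint.mul_const ((t - s) ^ α)).mono' ?_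
      (Filter.Eventually.of_forall fun θ => (hΓ θ).1 s t hs hst ht)
    refine (stronglyMeasurable_of_tendsto Filter.atTop
      (fun n => ((hF n).comp fun γ => γ s t).stronglyMeasurable) ?_).aestronglyMeasurable
    refine tendsto_pi_nhds.2 fun θ => tendsto_iff_norm_sub_tendsto_zero.2 ?_
    refine squeeze_zero (fun _ => norm_nonneg _) (fun n => ?_)
      (by simpa using (hFlim θ).mul_const ((t - s) ^ α))
    rw [norm_sub_rev]
    exact (hd n θ).1 s t hs hst ht
  have hJint : ∀ t : ℝ, 0 ≤ t → t ≤ T → Integrable (fun θ => sew (Γ θ) t) μ := by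
    intro t ht0 ht
    refine ((hint.mul_const A).mul_const (T ^ α)).mono' ?_
      (Filter.Eventually.of_forall fun θ => ?_)
    · refine (stronglyMeasurable_of_tendsto Filter.atTop
        (fun n => ((hF n).comp fun γ => sew γ t).stronglyMeasurable) ?_).aestronglyMeasurable
      refine tendsto_pi_nhds.2 fun θ => tendsto_iff_norm_sub_tendsto_zero.2 ?_
      refine squeeze_zero (fun _ => norm_nonneg _) (fun n => ?_) (hscale θ (T ^ α))
      rw [norm_sub_rev]
      exact norm_le_of_holder (f := fun t => sew (Γ θ) t - sew (F n θ) t) hα0 (hL n θ)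
        (hD0 n θ) (hDh n θ) ht0 ht
    · exact norm_le_of_holder hα0 (mul_nonneg ((hΓ θ).nonneg hT) hA) (hJ0 θ)
        (fun s t hs hst ht => (hΓ θ).norm_sewing_sub_le hα0 hα1 hβ hT (hJ θ) hs hst ht) ht0 ht
  have hδ (s u t : ℝ) (hs : 0 ≤ s) (hsu : s ≤ u) (hut : u ≤ t) (ht : t ≤ T) :
      Integrable (fun θ => Γ θ s t - Γ θ s u - Γ θ u t) μ ∧
      (∫ θ, Γ θ s t ∂μ) - (∫ θ, Γ θ s u ∂μ) - ∫ θ, Γ θ u t ∂μ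
        = ∫ θ, (Γ θ s t - Γ θ s u - Γ θ u t) ∂μ := by
    have h1 := hΓint s t hs (hsu.trans hut) ht
    have h2 := hΓint s u hs hsu (hut.trans ht)
    have h3 := hΓint u t (hs.trans hsu) hut ht
    exact ⟨(h1.sub h2).sub h3, integral_sub_sub h1 h2 h3⟩
  refine ⟨fun θ => sew (Γ θ), fun θ => ⟨hJ0 θ, _, hJ θ⟩,
    ⟨fun n θ => sew (F n θ), fun n => (hF n).comp sew, fun n θ => ?_, fun θ => ?_⟩,
    hΓint, ⟨∫ θ, germNorm α β T (Γ θ) ∂μ, ?_, ?_⟩, ?_, hJint,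
    ⟨fun t => ∫ θ, sew (Γ θ) t ∂μ, by simp [hJ0],
      ⟨C * ∫ θ, germNorm α β T (Γ θ) ∂μ, ?_⟩, fun t _ _ => rfl⟩⟩
  · set L := germNorm α β T (fun s t => Γ θ s t - F n θ s t) * A
    have hL' : 0 ≤ L := hL n θ
    refine ⟨max (L * T ^ α) L, fun t ht0 ht => ?_, fun s t hs hst ht => ?_⟩
    · exact (norm_le_of_holder (f := fun t => sew (Γ θ) t - sew (F n θ) t) hα0 hL'
        (hD0 n θ) (hDh n θ) ht0 ht).trans (le_max_left _ _)
    · exact (hDh n θ s t hs hst ht).trans (mul_le_mul_of_nonneg_right (le_max_right _ _)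
        (Real.rpow_nonneg (sub_nonneg.2 hst) _))
  · exact squeeze_zero (fun n => pathNorm_nonneg _ _ _)
      (fun n => pathNorm_le_of_holder hα0 hT (hL n θ) (hD0 n θ) (hDh n θ)) (hscale θ (T ^ α + 1))
  · intro s t hs hst ht
    rw [← integral_mul_const]
    exact norm_integral_le_of_norm_le (hint.mul_const _)
      (Filter.Eventually.of_forall fun θ => (hΓ θ).1 s t hs hst ht)
  · intro s u t hs hsu hut ht
    rw [(hδ s u t hs hsu hut ht).2, ← integral_mul_const]
    exact norm_integral_le_of_norm_le (hint.mul_const _)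
      (Filter.Eventually.of_forall fun θ => (hΓ θ).2 s u t hs hsu hut ht)
  · refine germNorm_le hT fun s t s' u' t' hs hst ht hs' hsu' hut' hst' ht' => ?_
    have h1 := (hΓint s t hs hst.le ht).norm.div_const ((t - s) ^ α)
    obtain ⟨h2, h3⟩ := hδ s' u' t' hs' hsu' hut' ht'
    have h4 := h2.norm.div_const ((t' - s') ^ β)
    have h5 := Real.rpow_pos_of_pos (sub_pos.2 hst) α
    have h6 := Real.rpow_pos_of_pos (sub_pos.2 hst') β
    calc _ ≤ (∫ θ, ‖Γ θ s t‖ ∂μ) / (t - s) ^ α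
          + (∫ θ, ‖Γ θ s' t' - Γ θ s' u' - Γ θ u' t'‖ ∂μ) / (t' - s') ^ β := by
            rw [h3]
            gcongr <;> exact norm_integral_le_integral_norm _
      _ = ∫ θ, (‖Γ θ s t‖ / (t - s) ^ α
          + ‖Γ θ s' t' - Γ θ s' u' - Γ θ u' t'‖ / (t' - s') ^ β) ∂μ := by
            rw [integral_add h1 h4, integral_div, integral_div]
      _ ≤ _ := integral_mono (h1.add h4) hint fun θ =>
            (hΓ θ).div_add_div_le_germNorm hs hst ht hs' hsu' hut' hst' ht'
  · intro s t hs hst ht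
    have h1 := hJint t (hs.trans hst) ht
    have h2 := hJint s hs (hst.trans ht)
    have h3 := hΓint s t hs hst ht
    rw [integral_sub_sub h1 h2 h3, ← integral_const_mul, ← integral_mul_const]
    exact norm_integral_le_of_norm_le ((hint.const_mul C).mul_const _)
      (Filter.Eventually.of_forall fun θ => hJ θ s t hs hst ht)
end
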